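/- arXiv:2405.16276 — 10 statements merged into one kernel-verified Lean document; each statement's English description precedes it below -/
import Mathlib

section
/- In the RLHF Game with a SW-Max training rule ψ and zero payments, under summation normalization of reward models, suppose f is strictly convex and continuously differentiable on (0,∞) and for every profile the SW-Max maximizer has full support. If group i's reward model r_i takes at least two distinct values on X (s_i ≥ 2) and min_{x∈X} r_i(x) > 0, then there exists a summation-normalized reward model r'_i ≠ r_i such that for every profile of other groups' reported reward models and sizes, every size vector, and every full-support initial model π₀, v(ψ((r'_i, r⃗_{-i}), w⃗, π₀); r_i) > v(ψ((r_i, r⃗_{-i}), w⃗, π₀); r_i); that is, misreporting r'_i yields strictly higher utility than truthful reporting regardless of others' reports. -/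
open Finset

noncomputable section

variable {X : Type*}

/-- A model is a probability distribution on the finite outcome set `X`. -/
def IsModel [Fintype X] (π : X → ℝ) : Prop :=
  (∀ x, 0 ≤ π x) ∧ ∑ x, π x = 1

/-- A function on `X` has full support if it is everywhere positive. -/
def FullSupport (π : X → ℝ) : Prop :=
  ∀ x, 0 < π x

/-- A reward model normalized by summation. -/
def IsRewardSum [Fintype X] (r : X → ℝ) : Prop :=
  (∀ x, 0 ≤ r x) ∧ ∑ x, r x = 1

/-- A reward model normalized by maximum. -/
def IsRewardMax (r : X → ℝ) : Prop :=
  (∀ x, 0 ≤ r x) ∧ (∀ x, r x ≤ 1) ∧ ∃ x, r x = 1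

/-- The valuation of a model `π` under a reward model `r`. -/
def valuation [Fintype X] (π r : X → ℝ) : ℝ :=
  ∑ x, π x * r x

/-- The `f`-divergence between `π` and `π₀`. -/
def fDiv [Fintype X] (f : ℝ → ℝ) (π π₀ : X → ℝ) : ℝ :=
  ∑ x, π₀ x * f (π x / π₀ x)

/-- The affine social welfare. -/
def ASW [Fintype X] (f : ℝ → ℝ) {n : ℕ} (r : Fin n → X → ℝ) (w : Fin n → ℕ)
    (π π₀ : X → ℝ) : ℝ :=
  (∑ i, (w i : ℝ) * valuation π (r i)) - fDiv f π π₀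

/-- A SW-Max training rule: on every profile of reward models in the domain `Rdom`
and every full-support initial model, it outputs a model maximizing the affine social
welfare.  Weight vectors range over all of `ℕ` so that the rule is also defined on
profiles with a group removed (encoded by a zero weight). -/
def SWMaxRule [Fintype X] (f : ℝ → ℝ) (Rdom : (X → ℝ) → Prop) {n : ℕ}
    (ψ : (Fin n → X → ℝ) → (Fin n → ℕ) → (X → ℝ) → (X → ℝ)) : Prop :=
  ∀ (r : Fin n → X → ℝ) (w : Fin n → ℕ) (π₀ : X → ℝ),
    (∀ j, Rdom (r j)) → IsModel π₀ → FullSupport π₀ →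
      IsModel (ψ r w π₀) ∧
      ∀ π : X → ℝ, IsModel π → ASW f r w π π₀ ≤ ASW f r w (ψ r w π₀) π₀

/-- Along a direction of total mass zero, a fully supported model stays a model for a short time. -/
lemma eventually_isModel_add_smul [Fintype X] {π : X → ℝ} (hπ : IsModel π)
    (hpos : FullSupport π) {d : X → ℝ} (hd : ∑ x, d x = 0) :
    ∀ᶠ s : ℝ in nhds 0, IsModel (fun x => π x + s * d x) := by
  have h : ∀ x, ∀ᶠ s : ℝ in nhds 0, 0 < π x + s * d x := fun x => by
    have hc : ContinuousAt (fun s : ℝ => π x + s * d x) 0 := by fun_prop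
    exact hc.eventually (lt_mem_nhds (by simpa using hpos x))
  filter_upwards [Filter.eventually_all.2 h] with s hs
  refine ⟨fun x => (hs x).le, ?_⟩
  rw [sum_add_distrib, ← mul_sum, hd, hπ.2, mul_zero, add_zero]

lemma valuation_add_smul [Fintype X] (π d r : X → ℝ) (s : ℝ) :
    valuation (fun x => π x + s * d x) r = valuation π r + s * valuation d r := by
  simp only [valuation, mul_sum, ← sum_add_distrib]
  exact sum_congr rfl fun x _ => by ring

/-- The affine social welfare is differentiable along lines through fully supported models. -/
lemma differentiableAt_ASW_add_smul [Fintype X] {f : ℝ → ℝ}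
    (hf : DifferentiableOn ℝ f (Set.Ioi 0)) {n : ℕ} (r : Fin n → X → ℝ) (w : Fin n → ℕ)
    {π π₀ : X → ℝ} (hπ : FullSupport π) (hπ₀ : FullSupport π₀) (d : X → ℝ) :
    DifferentiableAt ℝ (fun s : ℝ => ASW f r w (fun x => π x + s * d x) π₀) 0 := by
  have h : ∀ x, DifferentiableAt ℝ (fun s : ℝ => f ((π x + s * d x) / π₀ x)) 0 := fun x => by
    have hp : 0 < (π x + 0 * d x) / π₀ x := by simpa using div_pos (hπ x) (hπ₀ x)
    exact DifferentiableAt.comp (g := f) (0 : ℝ)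
      (hf.differentiableAt (Ioi_mem_nhds hp)) (by fun_prop)
  simp only [ASW, valuation_add_smul, fDiv]
  exact (DifferentiableAt.fun_sum fun j _ => by fun_prop).sub
    (DifferentiableAt.fun_sum fun x _ => (h x).const_mul _)

/-- If a fully supported model maximizes both the affine social welfare and its perturbation by a
nonzero multiple of the valuation under `q`, then `q` is constant. -/
lemma eq_of_isMax_ASW_of_isMax_ASW_add [Fintype X] {f : ℝ → ℝ}
    (hf : DifferentiableOn ℝ f (Set.Ioi 0)) {n : ℕ} {r : Fin n → X → ℝ} {w : Fin n → ℕ}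
    {π π₀ q : X → ℝ} {c : ℝ} (hc : c ≠ 0) (hπ : IsModel π) (hpos : FullSupport π)
    (hπ₀ : FullSupport π₀)
    (hmax : ∀ p, IsModel p → ASW f r w p π₀ ≤ ASW f r w π π₀)
    (hmax' : ∀ p, IsModel p →
      ASW f r w p π₀ + c * valuation p q ≤ ASW f r w π π₀ + c * valuation π q) (x y : X) :
    q x = q y := by
  classical
  set d : X → ℝ := Pi.single x 1 - Pi.single y 1 with hd
  have hsum : ∑ z, d z = 0 := by simp [hd]
  have hval : valuation d q = q x - q y := by
    simp [hd, valuation, sub_mul, Pi.single_apply]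
  have hev := eventually_isModel_add_smul hπ hpos hsum
  have hD := (differentiableAt_ASW_add_smul hf r w hpos hπ₀ d).hasDerivAt
  have hD0 := IsLocalMax.hasDerivAt_eq_zero
    (by filter_upwards [hev] with s hs using by simpa using hmax _ hs) hD
  have hV : HasDerivAt (fun s : ℝ => c * (valuation π q + s * valuation d q))
      (c * (1 * valuation d q)) 0 :=
    (((hasDerivAt_id (0 : ℝ)).mul_const _).const_add _).const_mul c
  have hDV0 := IsLocalMax.hasDerivAt_eq_zero
    (by filter_upwards [hev] with s hs using by
          simpa [valuation_add_smul] using hmax' _ hs) (hD.add hV)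
  rw [hD0, hval, zero_add, one_mul] at hDV0
  exact sub_eq_zero.1 ((mul_eq_zero.1 hDV0).resolve_left hc)

lemma ASW_update [Fintype X] (f : ℝ → ℝ) {n : ℕ} (r : Fin n → X → ℝ) (w : Fin n → ℕ)
    (i : Fin n) (q π π₀ : X → ℝ) :
    ASW f (Function.update r i q) w π π₀ =
      ASW f r w π π₀ + w i * (valuation π q - valuation π (r i)) := by
  have h : ∑ j, (w j : ℝ) * valuation π (Function.update r i q j) =
      ∑ j, (w j : ℝ) * valuation π (r j) + w i * (valuation π q - valuation π (r i)) := by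
    rw [← add_sum_erase _ _ (mem_univ i), ← add_sum_erase univ
      (fun j => (w j : ℝ) * valuation π (r j)) (mem_univ i), Function.update_self,
      sum_congr rfl fun j hj => by rw [Function.update_of_ne (ne_of_mem_erase hj)]]
    ring
  rw [ASW, ASW, h]
  ring

/-- summation normalization; if `s_i ≥ 2` and `min r_i > 0`, some
misreport is strictly better than truth-telling regardless of others' reports. -/
theorem swmax_sum_norm_profitable_misreport
    [Fintype X] [Nonempty X] {n : ℕ} (f : ℝ → ℝ)
    (hconv : StrictConvexOn ℝ (Set.Ioi 0) f) (hf1 : f 1 = 0)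
    (hsmooth : ContDiffOn ℝ 1 f (Set.Ioi 0))
    (ψ : (Fin n → X → ℝ) → (Fin n → ℕ) → (X → ℝ) → (X → ℝ))
    (hψ : SWMaxRule f (IsRewardSum (X := X)) ψ)
    (hfull : ∀ (r : Fin n → X → ℝ) (w : Fin n → ℕ) (π₀ : X → ℝ),
      (∀ j, IsRewardSum (r j)) → IsModel π₀ → FullSupport π₀ →
      FullSupport (ψ r w π₀))
    (i : Fin n) (rᵢ : X → ℝ) (hrᵢ : IsRewardSum rᵢ)
    (hs : ∃ x y, rᵢ x ≠ rᵢ y)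
    (hmin : ∀ x, 0 < rᵢ x) :
    ∃ r' : X → ℝ, IsRewardSum r' ∧ r' ≠ rᵢ ∧
      ∀ (r : Fin n → X → ℝ) (w : Fin n → ℕ) (π₀ : X → ℝ),
        r i = rᵢ → (∀ j, IsRewardSum (r j)) → (∀ j, 1 ≤ w j) →
        IsModel π₀ → FullSupport π₀ →
        valuation (ψ (Function.update r i r') w π₀) rᵢ >
          valuation (ψ r w π₀) rᵢ := by
  classical
  obtain ⟨x, y, hxy⟩ := hs
  obtain ⟨x₀, hx₀⟩ := Finite.exists_min rᵢ
  have hN : (1 : ℝ) ≤ Fintype.card X := by exact_mod_cast Fintype.card_pos (α := X)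
  have hN0 : (Fintype.card X : ℝ) ≠ 0 := by positivity
  set t : ℝ := rᵢ x₀ with ht
  have ht0 : 0 < t := hmin x₀
  set u : ℝ := (Fintype.card X : ℝ)⁻¹ with hu
  have hu1 : u ≤ 1 := inv_le_one_of_one_le₀ hN
  set q : X → ℝ := fun z => rᵢ z + t * (rᵢ z - u) with hq
  have hqR : IsRewardSum q := by
    refine ⟨fun z => ?_, ?_⟩
    · have := mul_pos ht0 (hmin z)
      have := mul_le_mul_of_nonneg_left hu1 ht0.le
      have := hx₀ z
      simp only [hq]
      linarith
    · simp [hq, sum_add_distrib, ← mul_sum, hrᵢ.2, hu, hN0]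
  have hqv : ∀ π, IsModel π → valuation π q = valuation π rᵢ + t * (valuation π rᵢ - u) := by
    intro π hπ
    calc valuation π q = ∑ z, (π z * rᵢ z + t * (π z * rᵢ z - u * π z)) :=
          sum_congr rfl fun z _ => by simp only [hq]; ring
      _ = _ := by
          rw [sum_add_distrib, ← mul_sum, sum_sub_distrib, ← mul_sum, hπ.2, mul_one]
          rfl
  refine ⟨q, hqR, fun h => hxy ?_, ?_⟩
  · have h' : ∀ z, rᵢ z = u := fun z => by
      have h1 : rᵢ z + t * (rᵢ z - u) = rᵢ z := congrFun h z
      have h2 : t * (rᵢ z - u) = 0 := by linarith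
      exact sub_eq_zero.1 ((mul_eq_zero.1 h2).resolve_left ht0.ne')
    rw [h', h']
  intro r w π₀ hri hr hw hπ₀ hpos₀
  have hr' : ∀ j, IsRewardSum (Function.update r i q j) := fun j => by
    rcases eq_or_ne j i with rfl | hj
    · rwa [Function.update_self]
    · rw [Function.update_of_ne hj]
      exact hr j
  obtain ⟨hπ, hmax⟩ := hψ r w π₀ hr hπ₀ hpos₀
  obtain ⟨hπ', hmax'⟩ := hψ _ w π₀ hr' hπ₀ hpos₀
  have hpos' := hfull _ w π₀ hr' hπ₀ hpos₀
  set π := ψ r w π₀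
  set π' := ψ (Function.update r i q) w π₀
  have hc : 0 < (w i : ℝ) * t := mul_pos (by exact_mod_cast hw i) ht0
  have hmaxc : ∀ p, IsModel p → ASW f r w p π₀ + (w i * t) * valuation p rᵢ ≤
      ASW f r w π' π₀ + (w i * t) * valuation π' rᵢ := fun p hp => by
    have := hmax' p hp
    rw [ASW_update, ASW_update, hri, hqv p hp, hqv π' hπ'] at this
    linarith
  by_contra! hle
  have hππ' : ASW f r w π π₀ ≤ ASW f r w π' π₀ := by
    have := hmaxc π hπ
    have := mul_le_mul_of_nonneg_left hle hc.le
    linarith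
  exact hxy (eq_of_isMax_ASW_of_isMax_ASW_add (hsmooth.differentiableOn one_ne_zero) hc.ne'
    hπ' hpos' hpos₀ (fun p hp => (hmax p hp).trans hππ') hmaxc x y)
end
end

section
/- In the RLHF Game with a SW-Max training rule ψ and zero payments, under maximum normalization of reward models, suppose f is strictly convex and continuously differentiable on (0,∞) and for every profile the SW-Max maximizer has full support. If group i's reward model r_i takes at least two distinct values on X (s_i ≥ 2) and min_{x∈X} r_i(x) > 0, then there exists a maximum-normalized reward model r'_i ≠ r_i such that for every profile of other groups' reported reward models and sizes, every size vector, and every full-support initial model π₀, v(ψ((r'_i, r⃗_{-i}), w⃗, π₀); r_i) > v(ψ((r_i, r⃗_{-i}), w⃗, π₀); r_i); that is, misreporting r'_i yields strictly higher utility than truthful reporting regardless of others' reports. -/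
open Finset

noncomputable section

variable {X : Type*}

/-- The aggregated reward `∑ j, w j * r j x` of an outcome `x`. -/
def aggReward {n : ℕ} (r : Fin n → X → ℝ) (w : Fin n → ℕ) (x : X) : ℝ :=
  ∑ j, (w j : ℝ) * r j x

lemma ASW_eq_sum [Fintype X] (f : ℝ → ℝ) {n : ℕ} (r : Fin n → X → ℝ) (w : Fin n → ℕ)
    (π π₀ : X → ℝ) :
    ASW f r w π π₀ = ∑ x, (π x * aggReward r w x - π₀ x * f (π x / π₀ x)) := by
  unfold ASW valuation fDiv aggReward
  rw [Finset.sum_sub_distrib]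
  congr 1
  simp_rw [Finset.mul_sum]
  rw [Finset.sum_comm]
  exact Finset.sum_congr rfl fun x _ => Finset.sum_congr rfl fun j _ => by ring

lemma aggReward_update {n : ℕ} (r : Fin n → X → ℝ) (w : Fin n → ℕ) (i : Fin n)
    (s : X → ℝ) (x : X) :
    aggReward (Function.update r i s) w x = aggReward r w x + w i * (s x - r i x) := by
  unfold aggReward
  rw [← Finset.add_sum_erase _ _ (Finset.mem_univ i),
    ← Finset.add_sum_erase univ (fun j => (w j : ℝ) * r j x) (Finset.mem_univ i)]
  have : ∑ j ∈ univ.erase i, (w j : ℝ) * Function.update r i s j x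
      = ∑ j ∈ univ.erase i, (w j : ℝ) * r j x :=
    Finset.sum_congr rfl fun j hj => by rw [Function.update_of_ne (Finset.ne_of_mem_erase hj)]
  rw [this, Function.update_self]
  ring

/-- First-order condition for a fully supported maximizer of the affine social welfare: the
quantity `f' (π x / π₀ x) - aggReward r w x` does not depend on `x`. -/
lemma deriv_sub_aggReward_eq_of_maximizer [Fintype X] {n : ℕ} {f : ℝ → ℝ}
    (hf : ∀ u, 0 < u → DifferentiableAt ℝ f u) {r : Fin n → X → ℝ} {w : Fin n → ℕ}
    {π π₀ : X → ℝ} (hπ : IsModel π) (hpos : FullSupport π) (h₀ : FullSupport π₀)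
    (hmax : ∀ ρ : X → ℝ, IsModel ρ → ASW f r w ρ π₀ ≤ ASW f r w π π₀) (x y : X) :
    deriv f (π x / π₀ x) - aggReward r w x = deriv f (π y / π₀ y) - aggReward r w y := by
  classical
  set e : X → ℝ := Pi.single x 1 - Pi.single y 1 with he
  have hsum (g : X → ℝ) : ∑ z, e z * g z = g x - g y := by
    simp [he, sub_mul, Finset.sum_sub_distrib, Pi.single_apply]
  have hderiv : HasDerivAt (fun t : ℝ => ASW f r w (fun z => π z + t * e z) π₀)
      (∑ z, e z * (aggReward r w z - deriv f (π z / π₀ z))) 0 := by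
    simp_rw [ASW_eq_sum]
    refine HasDerivAt.fun_sum fun z _ => ?_
    have hline : HasDerivAt (fun t : ℝ => π z + t * e z) (e z) 0 := by
      simpa using ((hasDerivAt_id (0 : ℝ)).mul_const (e z)).const_add (π z)
    have hf' : HasDerivAt f (deriv f (π z / π₀ z)) ((π z + 0 * e z) / π₀ z) := by
      simpa using (hf _ (div_pos (hpos z) (h₀ z))).hasDerivAt
    refine ((hline.mul_const (aggReward r w z)).sub
      ((hf'.comp (0 : ℝ) (hline.div_const (π₀ z))).const_mul (π₀ z))).congr_deriv ?_
    have := (h₀ z).ne'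
    generalize deriv f (π z / π₀ z) = d
    field_simp
  have hloc : IsLocalMax (fun t : ℝ => ASW f r w (fun z => π z + t * e z) π₀) 0 := by
    have hev : ∀ᶠ t : ℝ in nhds 0, ∀ z, 0 < π z + t * e z := by
      refine Filter.eventually_all.2 fun z => ?_
      have hcont : Continuous fun t : ℝ => π z + t * e z := by fun_prop
      exact hcont.continuousAt.eventually (lt_mem_nhds (by simpa using hpos z))
    filter_upwards [hev] with t ht
    have hmodel : IsModel fun z => π z + t * e z := by
      refine ⟨fun z => (ht z).le, ?_⟩
      have h := hsum fun _ => 1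
      simp only [mul_one, sub_self] at h
      rw [Finset.sum_add_distrib, ← Finset.mul_sum, h, hπ.2]
      ring
    simpa using hmax _ hmodel
  have h := hloc.hasDerivAt_eq_zero hderiv
  rw [hsum] at h
  linarith

/-- If the aggregated reward weakly decreases everywhere, strictly somewhere, then a fully
supported maximizer strictly gains mass on every outcome whose aggregated reward is unchanged. -/
lemma lt_of_aggReward_le [Fintype X] {n : ℕ} {f : ℝ → ℝ}
    (hconv : StrictConvexOn ℝ (Set.Ioi 0) f)
    (hf : ∀ u, 0 < u → DifferentiableAt ℝ f u) {r s : Fin n → X → ℝ} {w : Fin n → ℕ}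
    {π ρ π₀ : X → ℝ} (hπ : IsModel π) (hρ : IsModel ρ) (hπpos : FullSupport π)
    (hρpos : FullSupport ρ) (h₀ : FullSupport π₀)
    (hπmax : ∀ τ : X → ℝ, IsModel τ → ASW f r w τ π₀ ≤ ASW f r w π π₀)
    (hρmax : ∀ τ : X → ℝ, IsModel τ → ASW f s w τ π₀ ≤ ASW f s w ρ π₀)
    (hle : ∀ x, aggReward s w x ≤ aggReward r w x) {m : X}
    (hlt : aggReward s w m < aggReward r w m) {x : X}
    (hx : aggReward s w x = aggReward r w x) : π x < ρ x := by
  have hmono : StrictMonoOn (deriv f) (Set.Ioi 0) :=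
    hconv.strictMonoOn_deriv fun u hu => hf u hu
  have hpos {τ : X → ℝ} (hτ : FullSupport τ) (z : X) : τ z / π₀ z ∈ Set.Ioi (0 : ℝ) :=
    div_pos (hτ z) (h₀ z)
  have lt_of_deriv {τ σ : X → ℝ} (hτ : FullSupport τ) (hσ : FullSupport σ) {z : X}
      (h : deriv f (τ z / π₀ z) < deriv f (σ z / π₀ z)) : τ z < σ z :=
    (div_lt_div_iff_of_pos_right (h₀ z)).1 ((hmono.lt_iff_lt (hpos hτ z) (hpos hσ z)).1 h)
  have le_of_deriv {τ σ : X → ℝ} (hτ : FullSupport τ) (hσ : FullSupport σ) {z : X}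
      (h : deriv f (τ z / π₀ z) ≤ deriv f (σ z / π₀ z)) : τ z ≤ σ z :=
    (div_le_div_iff_of_pos_right (h₀ z)).1 ((hmono.le_iff_le (hpos hτ z) (hpos hσ z)).1 h)
  have hπfoc := deriv_sub_aggReward_eq_of_maximizer hf hπ hπpos h₀ hπmax
  have hρfoc := deriv_sub_aggReward_eq_of_maximizer hf hρ hρpos h₀ hρmax
  by_contra! hcon
  have hdx : deriv f (ρ x / π₀ x) ≤ deriv f (π x / π₀ x) :=
    (hmono.le_iff_le (hpos hρpos x) (hpos hπpos x)).2
      ((div_le_div_iff_of_pos_right (h₀ x)).2 hcon)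
  have hall (z : X) : ρ z ≤ π z :=
    le_of_deriv hρpos hπpos (by linarith [hπfoc z x, hρfoc z x, hle z])
  have hm : ρ m < π m :=
    lt_of_deriv hρpos hπpos (by linarith [hπfoc m x, hρfoc m x])
  have := Finset.sum_lt_sum (fun z _ => hall z) ⟨m, Finset.mem_univ m, hm⟩
  rw [hρ.2, hπ.2] at this
  exact this.false

/-- maximum normalization; if `s_i ≥ 2` and `min r_i > 0`, some
misreport is strictly better than truth-telling regardless of others' reports. -/
theorem swmax_max_norm_profitable_misreport
    [Fintype X] [Nonempty X] {n : ℕ} (f : ℝ → ℝ)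
    (hconv : StrictConvexOn ℝ (Set.Ioi 0) f) (hf1 : f 1 = 0)
    (hsmooth : ContDiffOn ℝ 1 f (Set.Ioi 0))
    (ψ : (Fin n → X → ℝ) → (Fin n → ℕ) → (X → ℝ) → (X → ℝ))
    (hψ : SWMaxRule f (IsRewardMax (X := X)) ψ)
    (hfull : ∀ (r : Fin n → X → ℝ) (w : Fin n → ℕ) (π₀ : X → ℝ),
      (∀ j, IsRewardMax (r j)) → IsModel π₀ → FullSupport π₀ →
      FullSupport (ψ r w π₀))
    (i : Fin n) (rᵢ : X → ℝ) (hrᵢ : IsRewardMax rᵢ)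
    (hs : ∃ x y, rᵢ x ≠ rᵢ y)
    (hmin : ∀ x, 0 < rᵢ x) :
    ∃ r' : X → ℝ, IsRewardMax r' ∧ r' ≠ rᵢ ∧
      ∀ (r : Fin n → X → ℝ) (w : Fin n → ℕ) (π₀ : X → ℝ),
        r i = rᵢ → (∀ j, IsRewardMax (r j)) → (∀ j, 1 ≤ w j) →
        IsModel π₀ → FullSupport π₀ →
        valuation (ψ (Function.update r i r') w π₀) rᵢ >
          valuation (ψ r w π₀) rᵢ := by
  classical
  have hdiff (u : ℝ) (hu : 0 < u) : DifferentiableAt ℝ f u :=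
    (hsmooth.differentiableOn one_ne_zero).differentiableAt (Ioi_mem_nhds hu)
  obtain ⟨m, hm⟩ := Finite.exists_min rᵢ
  obtain ⟨M, hM⟩ := hrᵢ.2.2
  have hmM : rᵢ m < rᵢ M := by
    obtain ⟨x, y, hxy⟩ := hs
    refine lt_of_le_of_ne (hm M) fun h => hxy ?_
    have hconst (z : X) : rᵢ z = 1 := le_antisymm (hrᵢ.2.1 z) (by linarith [hm z])
    rw [hconst x, hconst y]
  set r' : X → ℝ := fun x => if rᵢ x = rᵢ m then 0 else rᵢ x with hr'
  have hr'_of_ne {x : X} (hx : rᵢ x ≠ rᵢ m) : r' x = rᵢ x := if_neg hx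
  have hr'm : r' m = 0 := if_pos rfl
  have hr'le (x : X) : r' x ≤ rᵢ x := by
    by_cases hx : rᵢ x = rᵢ m
    · rw [hr']
      simp only [if_pos hx]
      exact (hmin x).le
    · exact (hr'_of_ne hx).le
  have hr'max : IsRewardMax r' := by
    refine ⟨fun x => ?_, fun x => (hr'le x).trans (hrᵢ.2.1 x), M, ?_⟩
    · simp only [hr']
      split_ifs
      exacts [le_rfl, hrᵢ.1 x]
    · rw [hr'_of_ne hmM.ne', hM]
  refine ⟨r', hr'max, fun h => (hmin m).ne' (by rw [← hr'm, h]), ?_⟩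
  intro r w π₀ hri hr hw hπ₀ h₀
  have hupd (j : Fin n) : IsRewardMax (Function.update r i r' j) := by
    by_cases hj : j = i
    · subst hj
      rwa [Function.update_self]
    · rw [Function.update_of_ne hj]
      exact hr j
  obtain ⟨hπ, hπmax⟩ := hψ r w π₀ hr hπ₀ h₀
  obtain ⟨hρ, hρmax⟩ := hψ (Function.update r i r') w π₀ hupd hπ₀ h₀
  have hπpos := hfull r w π₀ hr hπ₀ h₀
  have hρpos := hfull (Function.update r i r') w π₀ hupd hπ₀ h₀
  set π := ψ r w π₀
  set ρ := ψ (Function.update r i r') w π₀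
  have hwi : (0 : ℝ) < w i := by exact_mod_cast hw i
  have hgain {x : X} (hx : rᵢ x ≠ rᵢ m) : π x < ρ x := by
    refine lt_of_aggReward_le hconv hdiff hπ hρ hπpos hρpos h₀ hπmax hρmax
      (fun z => ?_) (m := m) ?_ ?_
    · rw [aggReward_update, hri]
      nlinarith [hr'le z]
    · rw [aggReward_update, hri, hr'm]
      nlinarith [hmin m]
    · rw [aggReward_update, hri, hr'_of_ne hx]
      ring
  have hshift {τ : X → ℝ} (hτ : IsModel τ) :
      valuation τ rᵢ = ∑ x, τ x * (rᵢ x - rᵢ m) + rᵢ m := by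
    simp_rw [mul_sub]
    rw [Finset.sum_sub_distrib, ← Finset.sum_mul, hτ.2, valuation]
    ring
  rw [gt_iff_lt, hshift hπ, hshift hρ]
  refine add_lt_add_left (Finset.sum_lt_sum (fun x _ => ?_) ⟨M, Finset.mem_univ M, ?_⟩) _
  · by_cases hx : rᵢ x = rᵢ m
    · simp [hx]
    · exact mul_le_mul_of_nonneg_right (hgain hx).le (sub_nonneg.2 (hm x))
  · exact mul_lt_mul_of_pos_right (hgain hmM.ne') (sub_pos.2 hmM)
end
end

section
/- In the RLHF Game with a SW-Max training rule ψ and zero payments, under maximum normalization of reward models, suppose f is α-strongly convex for some α > 0 and twice continuously differentiable on (0,∞), and for every profile the SW-Max maximizer has full support. Fix a truthful profile (r⃗, w⃗, π₀), let π = ψ(r⃗, w⃗, π₀), and define t(z) = Σ_{x∈X} (r_i(z) − r_i(x)) · π₀(x) / f''(π(x)/π₀(x)). Suppose group i's reward model takes at least two distinct values on X (s_i ≥ 2) and min_{x∈X} r_i(x) = 0. If there exists x₁ ∈ X with t(x₁) ≠ 0 and 0 < r_i(x₁) < 1, then truthful reporting is not optimal for group i: there exists a maximum-normalized reward model r'_i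 with v(ψ((r'_i, r⃗_{-i}), w⃗, π₀); r_i) > v(ψ(r⃗, w⃗, π₀); r_i). -/
open Finset

noncomputable section

variable {X : Type*}

open Filter Topology

/-- The total reward of a point under a weighted profile. -/
def totalReward {n : ℕ} (r : Fin n → X → ℝ) (w : Fin n → ℕ) (x : X) : ℝ :=
  ∑ j, (w j : ℝ) * r j x

lemma ASW_eq_sum_totalReward [Fintype X] (f : ℝ → ℝ) {n : ℕ} (r : Fin n → X → ℝ)
    (w : Fin n → ℕ) (π π₀ : X → ℝ) :
    ASW f r w π π₀ = ∑ x, (π x * totalReward r w x - π₀ x * f (π x / π₀ x)) := by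
  unfold ASW fDiv valuation totalReward
  rw [Finset.sum_sub_distrib]
  congr 1
  simp only [Finset.mul_sum]
  rw [Finset.sum_comm]
  exact Finset.sum_congr rfl fun x _ => Finset.sum_congr rfl fun j _ => by ring

lemma totalReward_update {n : ℕ} (r : Fin n → X → ℝ) (w : Fin n → ℕ) (i : Fin n)
    (r' : X → ℝ) (x : X) :
    totalReward (Function.update r i r') w x
      = totalReward r w x + (w i : ℝ) * (r' x - r i x) := by
  unfold totalReward
  rw [← sub_eq_iff_eq_add', ← Finset.sum_sub_distrib, Finset.sum_eq_single i]
  · simp [mul_sub]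
  · intro j _ hj
    simp [Function.update_of_ne hj]
  · simp

/-- First-order condition at a fully supported maximizer of the regularized reward. -/
lemma firstOrder_of_isMax [Fintype X] {f f' : ℝ → ℝ} {p π₀ R : X → ℝ}
    (hd : ∀ y ∈ Set.Ioi (0 : ℝ), HasDerivAt f (f' y) y)
    (hp : IsModel p) (hpf : FullSupport p) (hπ₀ : FullSupport π₀)
    (hmax : ∀ q : X → ℝ, IsModel q →
      ∑ x, (q x * R x - π₀ x * f (q x / π₀ x)) ≤ ∑ x, (p x * R x - π₀ x * f (p x / π₀ x)))
    (x y : X) : R x - f' (p x / π₀ x) = R y - f' (p y / π₀ y) := by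
  classical
  set v : X → ℝ := fun z => (Pi.single x 1 : X → ℝ) z - (Pi.single y 1 : X → ℝ) z with hv
  have hvsum : ∑ z, v z = 0 := by simp [hv]
  set g : ℝ → ℝ := fun s =>
    ∑ z, ((p z + s * v z) * R z - π₀ z * f ((p z + s * v z) / π₀ z)) with hg
  have hder : HasDerivAt g (∑ z, v z * (R z - f' (p z / π₀ z))) 0 := by
    refine HasDerivAt.fun_sum fun z _ => ?_
    have hlin : HasDerivAt (fun s : ℝ => p z + s * v z) (v z) 0 := by
      simpa using ((hasDerivAt_id (0 : ℝ)).mul_const (v z)).const_add (p z)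
    have hpos : 0 < p z / π₀ z := div_pos (hpf z) (hπ₀ z)
    have hcomp := HasDerivAt.comp (h₂ := f) (h₂' := f' (p z / π₀ z)) (0 : ℝ)
      (by simpa using hd _ hpos) (hlin.div_const (π₀ z))
    have heq : v z * (R z - f' (p z / π₀ z))
        = v z * R z - π₀ z * (f' (p z / π₀ z) * (v z / π₀ z)) := by
      have := (hπ₀ z).ne'
      field_simp
    rw [heq]
    exact (hlin.mul_const (R z)).sub (hcomp.const_mul (π₀ z))
  have hloc : IsLocalMax g 0 := by
    have hev : ∀ᶠ s in 𝓝 (0 : ℝ), ∀ z, 0 < p z + s * v z := by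
      rw [eventually_all]
      intro z
      have hc : ContinuousAt (fun s : ℝ => p z + s * v z) 0 := by fun_prop
      exact hc.eventually_const_lt (by simpa using hpf z)
    filter_upwards [hev] with s hs
    have h := hmax (fun z => p z + s * v z) ⟨fun z => (hs z).le, by
      rw [Finset.sum_add_distrib, ← Finset.mul_sum, hvsum, hp.2]; simp⟩
    simpa [hg] using h
  have h0 := hloc.hasDerivAt_eq_zero hder
  simp only [hv, sub_mul, Finset.sum_sub_distrib] at h0
  simp [Pi.single_apply] at h0
  linarith

/-- Mean value theorem on the positive half-line, with a quantitative location of the point. -/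
lemma exists_mean_value_Ioi {g g' : ℝ → ℝ}
    (hd : ∀ y ∈ Set.Ioi (0 : ℝ), HasDerivAt g (g' y) y) {a b : ℝ} (ha : 0 < a) (hb : 0 < b) :
    ∃ c, 0 < c ∧ |c - a| ≤ |b - a| ∧ g b - g a = g' c * (b - a) := by
  rcases lt_trichotomy a b with hab | rfl | hab
  · obtain ⟨c, hc, h⟩ := exists_hasDerivAt_eq_slope g g' hab
      (fun y hy => (hd y (ha.trans_le hy.1)).continuousAt.continuousWithinAt)
      (fun y hy => hd y (ha.trans hy.1))
    refine ⟨c, ha.trans hc.1, ?_, ?_⟩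
    · rw [abs_of_pos (sub_pos.2 hc.1), abs_of_pos (sub_pos.2 hab)]; linarith [hc.2]
    · rw [h, div_mul_cancel₀ _ (sub_pos.2 hab).ne']
  · exact ⟨a, ha, by simp, by simp⟩
  · obtain ⟨c, hc, h⟩ := exists_hasDerivAt_eq_slope g g' hab
      (fun y hy => (hd y (hb.trans_le hy.1)).continuousAt.continuousWithinAt)
      (fun y hy => hd y (hb.trans hy.1))
    refine ⟨c, hb.trans hc.1, ?_, ?_⟩
    · rw [abs_of_neg (sub_neg.2 hc.2), abs_of_neg (sub_neg.2 hab)]; linarith [hc.1]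
    · have := (sub_pos.2 hab).ne'
      rw [h]; field_simp; ring

/-- For a mean-zero vector `d = a * (k * 1_{x₁} - μ)` with positive `a`, the factor is bounded by
`|k|` and the pairing of `d` with `ρ` is explicit. -/
lemma abs_shift_le_and_sum_mul [Fintype X] [DecidableEq X] {a d ρ : X → ℝ} {k μ : ℝ} {x₁ : X}
    (ha : ∀ x, 0 < a x) (hd : ∀ x, d x = a x * ((if x = x₁ then k else 0) - μ))
    (hsum : ∑ x, d x = 0) :
    (∀ x, |(if x = x₁ then k else 0) - μ| ≤ |k|) ∧
      (∑ x, a x) * ∑ x, d x * ρ x = k * a x₁ * ∑ x, (ρ x₁ - ρ x) * a x := by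
  set A := ∑ x, a x with hA
  have ha₁A : a x₁ ≤ A := Finset.single_le_sum (fun x _ => (ha x).le) (Finset.mem_univ x₁)
  have hApos : 0 < A := (ha x₁).trans_le ha₁A
  have hμ : k * a x₁ = μ * A := by
    simp only [hd, mul_sub, Finset.sum_sub_distrib, mul_ite, mul_zero] at hsum
    rw [Finset.sum_ite_eq', ← Finset.sum_mul] at hsum
    simp only [Finset.mem_univ, if_true] at hsum
    linarith
  refine ⟨fun x => ?_, ?_⟩
  · have hμ' : μ = k * (a x₁ / A) := by field_simp; linarith
    have h0 : 0 < a x₁ / A := div_pos (ha x₁) hApos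
    have h1 : a x₁ / A ≤ 1 := (div_le_one hApos).2 ha₁A
    split_ifs
    · rw [hμ', show k - k * (a x₁ / A) = k * (1 - a x₁ / A) by ring, abs_mul]
      exact mul_le_of_le_one_right (abs_nonneg k) (abs_le.2 ⟨by linarith, by linarith⟩)
    · rw [zero_sub, abs_neg, hμ', abs_mul]
      exact mul_le_of_le_one_right (abs_nonneg k) (abs_le.2 ⟨by linarith, by linarith⟩)
  · have e1 : ∑ x, d x * ρ x = k * a x₁ * ρ x₁ - μ * ∑ x, ρ x * a x := by
      have : ∀ x, d x * ρ x
          = (if x = x₁ then k * a x * ρ x else 0) - μ * (ρ x * a x) := by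
        intro x; rw [hd]; split_ifs <;> ring
      simp only [this, Finset.sum_sub_distrib, ← Finset.mul_sum]
      simp
    have e2 : ∑ x, (ρ x₁ - ρ x) * a x = ρ x₁ * A - ∑ x, ρ x * a x := by
      simp only [sub_mul, Finset.sum_sub_distrib, ← Finset.mul_sum, hA]
    rw [e1, e2]
    linear_combination (∑ x, ρ x * a x) * hμ

/-- maximum normalization, `f` α-strongly convex and C².  If
`s_i ≥ 2`, `min r_i = 0`, and there is `x₁` with `t x₁ ≠ 0` and `0 < r_i x₁ < 1`,
then truthful reporting is not optimal for group `i`. -/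
theorem swmax_max_norm_t_nonzero_not_optimal
    [Fintype X] [Nonempty X] {n : ℕ} (f f' f'' : ℝ → ℝ) (α : ℝ) (hα : 0 < α)
    (hconv : ConvexOn ℝ (Set.Ioi 0) f) (hf1 : f 1 = 0)
    (hd1 : ∀ y ∈ Set.Ioi (0 : ℝ), HasDerivAt f (f' y) y)
    (hd2 : ∀ y ∈ Set.Ioi (0 : ℝ), HasDerivAt f' (f'' y) y)
    (hc2 : ContinuousOn f'' (Set.Ioi 0))
    (hstrong : ∀ y ∈ Set.Ioi (0 : ℝ), α ≤ f'' y)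
    (ψ : (Fin n → X → ℝ) → (Fin n → ℕ) → (X → ℝ) → (X → ℝ))
    (hψ : SWMaxRule f (IsRewardMax (X := X)) ψ)
    (hfull : ∀ (r : Fin n → X → ℝ) (w : Fin n → ℕ) (π₀ : X → ℝ),
      (∀ j, IsRewardMax (r j)) → IsModel π₀ → FullSupport π₀ →
      FullSupport (ψ r w π₀))
    (i : Fin n) (r : Fin n → X → ℝ) (w : Fin n → ℕ) (π₀ : X → ℝ)
    (hr : ∀ j, IsRewardMax (r j)) (hw : ∀ j, 1 ≤ w j)
    (hπ₀ : IsModel π₀) (hfs : FullSupport π₀)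
    (hs : ∃ x y, r i x ≠ r i y)
    (hmin : ∃ x, r i x = 0)
    (hx₁ : ∃ x₁ : X,
      (∑ x, (r i x₁ - r i x) * π₀ x / f'' (ψ r w π₀ x / π₀ x)) ≠ 0 ∧
      0 < r i x₁ ∧ r i x₁ < 1) :
    ∃ r' : X → ℝ, IsRewardMax r' ∧
      valuation (ψ (Function.update r i r') w π₀) (r i) >
        valuation (ψ r w π₀) (r i) := by
  classical
  obtain ⟨x₁, ht, hx₁0, hx₁1⟩ := hx₁
  set p := ψ r w π₀ with hp
  set t := ∑ x, (r i x₁ - r i x) * π₀ x / f'' (p x / π₀ x) with htdef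
  have hpf : FullSupport p := hfull r w π₀ hr hπ₀ hfs
  have hpm : IsModel p := (hψ r w π₀ hr hπ₀ hfs).1
  have hξ₀ : ∀ x, 0 < p x / π₀ x := fun x => div_pos (hpf x) (hfs x)
  have hwpos : (0 : ℝ) < w i := by exact_mod_cast hw i
  have hcont : ContinuousAt
      (fun ξ : X → ℝ => t * ∑ x, (r i x₁ - r i x) * π₀ x / f'' (ξ x))
      (fun x => p x / π₀ x) := by
    refine continuousAt_const.mul (tendsto_finsetSum _ fun x _ => ?_)
    refine tendsto_const_nhds.div ?_ (hα.trans_le (hstrong _ (hξ₀ x))).ne'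
    exact ((hc2.continuousAt (Ioi_mem_nhds (hξ₀ x))).tendsto).comp
      (continuousAt_apply x _).tendsto
  obtain ⟨δ, hδ, hball⟩ := Metric.eventually_nhds_iff.1
    (hcont.eventually_const_lt (u := 0) (mul_self_pos.2 ht))
  obtain ⟨ε, hε0, hε1, hεδ, hεt⟩ : ∃ ε : ℝ, 0 ≤ r i x₁ + ε ∧ r i x₁ + ε ≤ 1 ∧
      |w i * ε| / α < δ ∧ 0 < ε * t := by
    have h1 : ∀ᶠ c in 𝓝 (0 : ℝ), 0 < r i x₁ + c * t :=
      ContinuousAt.tendsto (by fun_prop) |>.eventually_const_lt (by simpa using hx₁0)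
    have h2 : ∀ᶠ c in 𝓝 (0 : ℝ), r i x₁ + c * t < 1 :=
      ContinuousAt.tendsto (by fun_prop) |>.eventually_lt_const (by simpa using hx₁1)
    have h3 : ∀ᶠ c in 𝓝 (0 : ℝ), |w i * (c * t)| / α < δ :=
      ContinuousAt.tendsto (by fun_prop) |>.eventually_lt_const (by simpa using hδ)
    obtain ⟨c, ⟨⟨c1, c2⟩, c3⟩, c0⟩ :=
      ((((h1.and h2).and h3).filter_mono nhdsWithin_le_nhds).and
        (self_mem_nhdsWithin (s := Set.Ioi (0 : ℝ)))).exists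
    refine ⟨c * t, c1.le, c2.le, c3, ?_⟩
    rw [mul_assoc]
    exact mul_pos c0 (mul_self_pos.2 ht)
  set r' : X → ℝ := fun x => r i x + if x = x₁ then ε else 0 with hr'
  have hr'max : IsRewardMax r' := by
    refine ⟨fun x => ?_, fun x => ?_, ?_⟩
    · by_cases h : x = x₁
      · simpa [hr', h] using hε0
      · simpa [hr', h] using (hr i).1 x
    · by_cases h : x = x₁
      · simpa [hr', h] using hε1
      · simpa [hr', h] using (hr i).2.1 x
    · obtain ⟨x, hx⟩ := (hr i).2.2
      have h : x ≠ x₁ := by rintro rfl; linarith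
      exact ⟨x, by simpa [hr', h] using hx⟩
  refine ⟨r', hr'max, ?_⟩
  have hru : ∀ j, IsRewardMax (Function.update r i r' j) := by
    intro j
    by_cases h : j = i
    · subst h; simpa using hr'max
    · simpa [Function.update_of_ne h] using hr j
  set q := ψ (Function.update r i r') w π₀ with hq
  have hqf : FullSupport q := hfull _ w π₀ hru hπ₀ hfs
  have hqm : IsModel q := (hψ _ w π₀ hru hπ₀ hfs).1
  have hpfoc := firstOrder_of_isMax (R := totalReward r w) hd1 hpm hpf hfs fun π hπ => by
    simpa only [ASW_eq_sum_totalReward] using (hψ r w π₀ hr hπ₀ hfs).2 π hπ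
  have hqfoc := firstOrder_of_isMax (R := totalReward (Function.update r i r') w)
    hd1 hqm hqf hfs fun π hπ => by
      simpa only [ASW_eq_sum_totalReward] using (hψ _ w π₀ hru hπ₀ hfs).2 π hπ
  choose ξ hξpos hξdist hξ using fun x =>
    exists_mean_value_Ioi hd2 (hξ₀ x) (div_pos (hqf x) (hfs x))
  have hf''pos : ∀ x, 0 < f'' (ξ x) := fun x => hα.trans_le (hstrong _ (hξpos x))
  set μ : ℝ := (w i : ℝ) * (r' x₁ - r i x₁) - (f' (q x₁ / π₀ x₁) - f' (p x₁ / π₀ x₁)) with hμ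
  have hgap : ∀ x, f'' (ξ x) * (q x / π₀ x - p x / π₀ x)
      = (if x = x₁ then (w i : ℝ) * ε else 0) - μ := by
    intro x
    have h1 := hpfoc x x₁
    have h2 := hqfoc x x₁
    rw [totalReward_update, totalReward_update] at h2
    have h3 : (if x = x₁ then (w i : ℝ) * ε else 0) = (w i : ℝ) * (r' x - r i x) := by
      by_cases h : x = x₁ <;> simp [hr', h]
    rw [← hξ x, h3]
    linarith
  have hdiff : ∀ x, q x - p x
      = π₀ x / f'' (ξ x) * ((if x = x₁ then (w i : ℝ) * ε else 0) - μ) := by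
    intro x
    have := (hfs x).ne'
    have := (hf''pos x).ne'
    rw [← hgap]
    field_simp
  have hapos : ∀ x, 0 < π₀ x / f'' (ξ x) := fun x => div_pos (hfs x) (hf''pos x)
  obtain ⟨hbound, hval⟩ := abs_shift_le_and_sum_mul (ρ := r i) hapos hdiff
    (by rw [Finset.sum_sub_distrib, hqm.2, hpm.2, sub_self])
  have hdist : dist ξ (fun x => p x / π₀ x) < δ := by
    rw [dist_pi_lt_iff hδ]
    intro x
    rw [Real.dist_eq]
    refine ((hξdist x).trans ?_).trans_lt hεδ
    rw [le_div_iff₀ hα]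
    calc |q x / π₀ x - p x / π₀ x| * α
        ≤ |q x / π₀ x - p x / π₀ x| * f'' (ξ x) := by
          gcongr; exact hstrong _ (hξpos x)
      _ = |f'' (ξ x) * (q x / π₀ x - p x / π₀ x)| := by
          rw [abs_mul, abs_of_pos (hf''pos x), mul_comm]
      _ ≤ |w i * ε| := by rw [hgap]; exact hbound x
  have hpos := hball hdist
  simp only [mul_div_assoc] at hpos
  have hεpos : 0 < ε * ∑ x, (r i x₁ - r i x) * (π₀ x / f'' (ξ x)) := by
    refine pos_of_mul_pos_left (b := t * t) ?_ (mul_self_nonneg t)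
    calc 0 < (ε * t) * (t * ∑ x, (r i x₁ - r i x) * (π₀ x / f'' (ξ x))) := mul_pos hεt hpos
      _ = _ := by ring
  have hgain : 0 < ∑ x, (q x - p x) * r i x := by
    refine pos_of_mul_pos_right (a := ∑ x, π₀ x / f'' (ξ x)) ?_
      (Finset.sum_nonneg fun x _ => (hapos x).le)
    rw [hval]
    calc 0 < (w i * (π₀ x₁ / f'' (ξ x₁))) *
          (ε * ∑ x, (r i x₁ - r i x) * (π₀ x / f'' (ξ x))) :=
          mul_pos (mul_pos hwpos (hapos x₁)) hεpos
      _ = _ := by ring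
  simp only [sub_mul, Finset.sum_sub_distrib] at hgain
  exact sub_pos.1 hgain
end
end

section
/- In the RLHF Game with a SW-Max training rule ψ and zero payments, under summation normalization of reward models, suppose f is α-strongly convex for some α > 0 and twice continuously differentiable on (0,∞), and for every profile the SW-Max maximizer has full support. Fix a truthful profile (r⃗, w⃗, π₀), let π = ψ(r⃗, w⃗, π₀), and define t(z) = Σ_{x∈X} (r_i(z) − r_i(x)) · π₀(x) / f''(π(x)/π₀(x)). Suppose group i's reward model takes at least two distinct values on X (s_i ≥ 2) and min_{x∈X} r_i(x) = 0. If there exist x₁, x₂ ∈ X with t(x₁) > 0, 1 > r_i(x₁) ≥ r_i(x₂) > 0, and f''(π(x₁)/π₀(x₁))/π₀(x₁) < f''(π(x₂)/π₀(x₂))/π₀(x₂), then truthful reporting is not optimal for group i: there exists a summation-normalized reward model r'_i with v(ψ((r'_i, r⃗_{-i}), w⃗, π₀); r_i) > v(ψ(r⃗, w⃗, π₀); r_i). -/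
open Finset

noncomputable section

variable {X : Type*}

/-- The social reward of an outcome: the weighted sum of the reported rewards. -/
def socialReward {n : ℕ} (r : Fin n → X → ℝ) (w : Fin n → ℕ) (x : X) : ℝ :=
  ∑ j, (w j : ℝ) * r j x

lemma ASW_eq_socialReward [Fintype X] (f : ℝ → ℝ) {n : ℕ} (r : Fin n → X → ℝ)
    (w : Fin n → ℕ) (π π₀ : X → ℝ) :
    ASW f r w π π₀ = ∑ x, (π x * socialReward r w x - π₀ x * f (π x / π₀ x)) := by
  simp only [ASW, fDiv, valuation, socialReward, Finset.mul_sum, Finset.sum_sub_distrib]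
  rw [Finset.sum_comm]
  congr 1
  exact Finset.sum_congr rfl fun x _ => Finset.sum_congr rfl fun j _ => by ring

lemma socialReward_update [DecidableEq X] {n : ℕ} (r : Fin n → X → ℝ) (w : Fin n → ℕ)
    (i : Fin n) (d : X → ℝ) (x : X) :
    socialReward (Function.update r i (fun z => r i z + d z)) w x =
      socialReward r w x + w i * d x := by
  have h : ∀ j, (w j : ℝ) * Function.update r i (fun z => r i z + d z) j x =
      w j * r j x + if j = i then (w i : ℝ) * d x else 0 := by
    intro j
    by_cases hj : j = i
    · subst hj; simp [mul_add]
    · simp [hj]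
  simp [socialReward, h, Finset.sum_add_distrib]

/-- The directional derivative of the affine social welfare at a full-support model. -/
lemma hasDerivAt_ASW [Fintype X] {f f' : ℝ → ℝ} {n : ℕ} (r : Fin n → X → ℝ)
    (w : Fin n → ℕ) {π π₀ : X → ℝ} (hd : ∀ y ∈ Set.Ioi (0 : ℝ), HasDerivAt f (f' y) y)
    (hπ : FullSupport π) (hπ₀ : FullSupport π₀) (u : X → ℝ) :
    HasDerivAt (fun s : ℝ => ASW f r w (fun x => π x + s * u x) π₀)
      (∑ x, u x * (socialReward r w x - f' (π x / π₀ x))) 0 := by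
  simp only [ASW_eq_socialReward]
  refine HasDerivAt.fun_sum fun x _ => ?_
  have hlin : HasDerivAt (fun s : ℝ => π x + s * u x) (u x) 0 := by
    simpa using ((hasDerivAt_id (0 : ℝ)).mul_const (u x)).const_add (π x)
  have hf : HasDerivAt f (f' (π x / π₀ x)) ((π x + 0 * u x) / π₀ x) := by
    simpa using hd _ (div_pos (hπ x) (hπ₀ x))
  have h := (hlin.mul_const (socialReward r w x)).sub
    ((hf.comp (0 : ℝ) (hlin.div_const (π₀ x))).const_mul (π₀ x))
  refine h.congr_deriv ?_
  have := (hπ₀ x).ne'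
  field_simp

/-- First-order condition: at a full-support maximizer the marginal divergence and the social
reward differ by a constant. -/
lemma exists_multiplier_of_maximizer [Fintype X] [Nonempty X] {f f' : ℝ → ℝ} {n : ℕ}
    {r : Fin n → X → ℝ} {w : Fin n → ℕ} {π π₀ : X → ℝ}
    (hd : ∀ y ∈ Set.Ioi (0 : ℝ), HasDerivAt f (f' y) y)
    (hπ₀ : FullSupport π₀) (hπ : FullSupport π) (hmodel : IsModel π)
    (hmax : ∀ π' : X → ℝ, IsModel π' → ASW f r w π' π₀ ≤ ASW f r w π π₀) :
    ∃ c : ℝ, ∀ x, f' (π x / π₀ x) = socialReward r w x - c := by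
  classical
  obtain ⟨z⟩ := ‹Nonempty X›
  refine ⟨socialReward r w z - f' (π z / π₀ z), fun x => ?_⟩
  set u : X → ℝ := Pi.single x 1 - Pi.single z 1 with hu
  have hloc : IsLocalMax (fun s : ℝ => ASW f r w (fun x => π x + s * u x) π₀) 0 := by
    have hpos : ∀ᶠ s : ℝ in nhds 0, ∀ y, 0 < π y + s * u y := by
      refine Filter.eventually_all.2 fun y => ?_
      have hc : Continuous fun s : ℝ => π y + s * u y := by fun_prop
      exact hc.continuousAt.eventually (lt_mem_nhds (by simpa using hπ y))
    filter_upwards [hpos] with s hs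
    have := hmax (fun y => π y + s * u y) ⟨fun y => (hs y).le, by
      simp [Finset.sum_add_distrib, ← Finset.mul_sum, hu, hmodel.2]⟩
    simpa using this
  have h0 := hloc.hasDerivAt_eq_zero (hasDerivAt_ASW r w hd hπ hπ₀ u)
  simp [hu, sub_mul, Finset.sum_sub_distrib, Pi.single_apply] at h0
  linarith

/-- The mean value theorem on `(0, ∞)`, without an order assumption on the endpoints. -/
lemma exists_slope_eq_of_hasDerivAt {g g' : ℝ → ℝ}
    (hd : ∀ y ∈ Set.Ioi (0 : ℝ), HasDerivAt g (g' y) y) {u v : ℝ} (hu : 0 < u) (hv : 0 < v) :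
    ∃ ξ, 0 < ξ ∧ |ξ - u| ≤ |v - u| ∧ g v - g u = g' ξ * (v - u) := by
  have key : ∀ a b : ℝ, 0 < a → a < b →
      ∃ ξ ∈ Set.Ioo a b, g b - g a = g' ξ * (b - a) := by
    intro a b ha hab
    obtain ⟨ξ, hξ, h⟩ := exists_hasDerivAt_eq_slope g g' hab
      (fun y hy => (hd y (ha.trans_le hy.1)).continuousAt.continuousWithinAt)
      (fun y hy => hd y (ha.trans hy.1))
    refine ⟨ξ, hξ, ?_⟩
    rw [h, div_mul_cancel₀ _ (sub_pos.2 hab).ne']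
  rcases lt_trichotomy u v with h | rfl | h
  · obtain ⟨ξ, ⟨h1, h2⟩, e⟩ := key u v hu h
    refine ⟨ξ, hu.trans h1, ?_, e⟩
    rw [abs_of_pos (by linarith), abs_of_pos (by linarith)]
    linarith
  · exact ⟨u, hu, by simp, by simp⟩
  · obtain ⟨ξ, ⟨h1, h2⟩, e⟩ := key v u hv h
    refine ⟨ξ, hv.trans h1, ?_, by linarith⟩
    rw [abs_of_neg (by linarith), abs_of_neg (by linarith)]
    linarith

/-- If `b x * (c * d x - m)` has zero sum, with `b` positive and `|d| ≤ 1`, then `|m| ≤ c`. -/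
lemma abs_le_of_sum_mul_sub_eq_zero [Fintype X] [Nonempty X] {b d : X → ℝ} {c m : ℝ}
    (hb : ∀ x, 0 < b x) (hc : 0 ≤ c) (hd : ∀ x, |d x| ≤ 1)
    (hsum : ∑ x, b x * (c * d x - m) = 0) : |m| ≤ c := by
  have hcd : ∀ x, |c * d x| ≤ c := fun x => by
    rw [abs_mul, abs_of_nonneg hc]
    exact mul_le_of_le_one_right hc (hd x)
  refine abs_le.2 ⟨?_, ?_⟩ <;> by_contra! h
  · refine hsum.not_gt (Finset.sum_pos (fun x _ => mul_pos (hb x) ?_) Finset.univ_nonempty)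
    linarith [(abs_le.1 (hcd x)).1]
  · refine hsum.not_lt (Finset.sum_neg (fun x _ => mul_neg_of_pos_of_neg (hb x) ?_)
      Finset.univ_nonempty)
    linarith [(abs_le.1 (hcd x)).2]

/-- Shifting reward from `x₂` to `x₁` increases the value of the response
`b x * (c * (δ_{x₁} x - δ_{x₂} x) - m)` under `ρ`. -/
lemma sum_mul_response_pos [Fintype X] [Nonempty X] [DecidableEq X] {b ρ : X → ℝ} {c m : ℝ}
    {x₁ x₂ : X} (hb : ∀ x, 0 < b x) (hc : 0 < c) (hρ : ρ x₂ ≤ ρ x₁) (hb₁₂ : b x₂ < b x₁)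
    (ht : 0 < ∑ x, (ρ x₁ - ρ x) * b x)
    (hsum : ∑ x, b x * (c * (Pi.single x₁ 1 - Pi.single x₂ 1 : X → ℝ) x - m) = 0) :
    0 < ∑ x, b x * (c * (Pi.single x₁ 1 - Pi.single x₂ 1 : X → ℝ) x - m) * ρ x := by
  set A := ∑ x, b x with hA
  set B := ∑ x, ρ x * b x with hB
  have hApos : 0 < A := Finset.sum_pos (fun x _ => hb x) Finset.univ_nonempty
  have single_sum : ∀ g : X → ℝ,
      ∑ x, g x * (Pi.single x₁ 1 - Pi.single x₂ 1 : X → ℝ) x = g x₁ - g x₂ := fun g => by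
    simp [mul_sub, Finset.sum_sub_distrib, Pi.single_apply]
  have h1 : c * (b x₁ - b x₂) - m * A = 0 := by
    rw [← hsum, ← single_sum, hA, Finset.mul_sum, Finset.mul_sum, ← Finset.sum_sub_distrib]
    exact Finset.sum_congr rfl fun x _ => by ring
  have h2 : ∑ x, b x * (c * (Pi.single x₁ 1 - Pi.single x₂ 1 : X → ℝ) x - m) * ρ x =
      c * (b x₁ * ρ x₁ - b x₂ * ρ x₂) - m * B := by
    rw [← single_sum fun x => b x * ρ x, hB, Finset.mul_sum, Finset.mul_sum,
      ← Finset.sum_sub_distrib]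
    exact Finset.sum_congr rfl fun x _ => by ring
  have h3 : ∑ x, (ρ x₁ - ρ x) * b x = ρ x₁ * A - B := by
    simp [sub_mul, Finset.sum_sub_distrib, Finset.mul_sum, hA, hB]
  rw [h3] at ht
  rw [h2]
  have h4 : A * (c * (b x₁ * ρ x₁ - b x₂ * ρ x₂) - m * B) =
      c * ((b x₁ - b x₂) * (ρ x₁ * A - B) + b x₂ * A * (ρ x₁ - ρ x₂)) := by
    linear_combination B * h1
  refine pos_of_mul_pos_right ?_ hApos.le
  rw [h4]
  have := mul_pos (sub_pos.2 hb₁₂) ht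
  have := mul_nonneg (mul_pos (hb x₂) hApos).le (sub_nonneg.2 hρ)
  positivity

/-- summation normalization, `f` α-strongly convex and C².  If
`s_i ≥ 2`, `min r_i = 0`, and there are `x₁, x₂` with `t x₁ > 0`,
`1 > r_i x₁ ≥ r_i x₂ > 0` and `f''(π x₁/π₀ x₁)/π₀ x₁ < f''(π x₂/π₀ x₂)/π₀ x₂`,
then truthful reporting is not optimal for group `i`. -/
theorem swmax_sum_norm_t_pos_not_optimal
    [Fintype X] [Nonempty X] {n : ℕ} (f f' f'' : ℝ → ℝ) (α : ℝ) (hα : 0 < α)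
    (hconv : ConvexOn ℝ (Set.Ioi 0) f) (hf1 : f 1 = 0)
    (hd1 : ∀ y ∈ Set.Ioi (0 : ℝ), HasDerivAt f (f' y) y)
    (hd2 : ∀ y ∈ Set.Ioi (0 : ℝ), HasDerivAt f' (f'' y) y)
    (hc2 : ContinuousOn f'' (Set.Ioi 0))
    (hstrong : ∀ y ∈ Set.Ioi (0 : ℝ), α ≤ f'' y)
    (ψ : (Fin n → X → ℝ) → (Fin n → ℕ) → (X → ℝ) → (X → ℝ))
    (hψ : SWMaxRule f (IsRewardSum (X := X)) ψ)
    (hfull : ∀ (r : Fin n → X → ℝ) (w : Fin n → ℕ) (π₀ : X → ℝ),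
      (∀ j, IsRewardSum (r j)) → IsModel π₀ → FullSupport π₀ →
      FullSupport (ψ r w π₀))
    (i : Fin n) (r : Fin n → X → ℝ) (w : Fin n → ℕ) (π₀ : X → ℝ)
    (hr : ∀ j, IsRewardSum (r j)) (hw : ∀ j, 1 ≤ w j)
    (hπ₀ : IsModel π₀) (hfs : FullSupport π₀)
    (hs : ∃ x y, r i x ≠ r i y)
    (hmin : ∃ x, r i x = 0)
    (hx : ∃ x₁ x₂ : X,
      0 < (∑ x, (r i x₁ - r i x) * π₀ x / f'' (ψ r w π₀ x / π₀ x)) ∧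
      r i x₁ < 1 ∧ r i x₂ ≤ r i x₁ ∧ 0 < r i x₂ ∧
      f'' (ψ r w π₀ x₁ / π₀ x₁) / π₀ x₁ < f'' (ψ r w π₀ x₂ / π₀ x₂) / π₀ x₂) :
    ∃ r' : X → ℝ, IsRewardSum r' ∧
      valuation (ψ (Function.update r i r') w π₀) (r i) >
        valuation (ψ r w π₀) (r i) := by
  classical
  obtain ⟨x₁, x₂, ht, -, hle, hpos₂, hlt⟩ := hx
  obtain ⟨hmodel, hmax⟩ := hψ r w π₀ hr hπ₀ hfs
  have hπ := hfull r w π₀ hr hπ₀ hfs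
  set π := ψ r w π₀
  have hf''pos : ∀ y : ℝ, 0 < y → 0 < f'' y := fun y hy => hα.trans_le (hstrong y hy)
  have hy : ∀ x, 0 < π x / π₀ x := fun x => div_pos (hπ x) (hfs x)
  have hx₁₂ : x₁ ≠ x₂ := by rintro rfl; exact lt_irrefl _ hlt
  have hw0 : (0 : ℝ) < w i := by exact_mod_cast hw i
  have hcont : ∀ x, ContinuousAt (fun ξ : X → ℝ => f'' (ξ x)) fun x => π x / π₀ x := fun x =>
    ContinuousAt.comp (f := fun ξ : X → ℝ => ξ x)
      (hc2.continuousAt (Ioi_mem_nhds (hy x))) (continuous_apply x).continuousAt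
  have hnear : ∀ᶠ ξ : X → ℝ in nhds fun x => π x / π₀ x,
      0 < (∑ x, (r i x₁ - r i x) * π₀ x / f'' (ξ x)) ∧
        f'' (ξ x₁) / π₀ x₁ < f'' (ξ x₂) / π₀ x₂ := by
    refine Filter.Eventually.and ?_ ?_
    · have : ContinuousAt (fun ξ : X → ℝ => ∑ x, (r i x₁ - r i x) * π₀ x / f'' (ξ x))
          fun x => π x / π₀ x :=
        tendsto_finsetSum _ fun x _ =>
          ContinuousAt.div continuousAt_const (hcont x) (hf''pos _ (hy x)).ne'
      exact this.eventually (lt_mem_nhds ht)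
    · exact ((hcont x₁).div_const _).eventually_lt ((hcont x₂).div_const _) hlt
  obtain ⟨δ, hδ, hball⟩ := Metric.eventually_nhds_iff.1 hnear
  obtain ⟨ε, hε, hεr, hεδ⟩ : ∃ ε : ℝ, 0 < ε ∧ ε ≤ r i x₂ ∧ 2 * (w i * ε) / α < δ := by
    refine ⟨min (r i x₂) (α * δ / (4 * w i)), by positivity, min_le_left _ _, ?_⟩
    have h := min_le_right (r i x₂) (α * δ / (4 * w i))
    rw [le_div_iff₀ (by positivity)] at h
    rw [div_lt_iff₀ hα]
    have := mul_pos hα hδ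
    linarith
  set d : X → ℝ := Pi.single x₁ 1 - Pi.single x₂ 1 with hd
  have hdabs : ∀ x, |d x| ≤ 1 := by
    intro x
    by_cases h1 : x = x₁
    · subst h1; simp [hd, hx₁₂]
    · by_cases h2 : x = x₂
      · subst h2; simp [hd, h1]
      · simp [hd, h1, h2]
  set r' : X → ℝ := fun x => r i x + ε * d x with hr'def
  have hr' : IsRewardSum r' := by
    refine ⟨fun x => ?_, ?_⟩
    · have h0 := (hr i).1 x
      by_cases h2 : x = x₂
      · subst h2; simp [hr'def, hd, hx₁₂.symm, hεr]
      · have : 0 ≤ d x := by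
          by_cases h1 : x = x₁
          · subst h1; simp [hd, hx₁₂]
          · simp [hd, h1, h2]
        positivity
    · simp [hr'def, Finset.sum_add_distrib, ← Finset.mul_sum, hd, (hr i).2]
  refine ⟨r', hr', ?_⟩
  have hrr' : ∀ j, IsRewardSum (Function.update r i r' j) := by
    intro j
    by_cases hj : j = i
    · subst hj; simpa using hr'
    · simpa [hj] using hr j
  obtain ⟨hmodel', hmax'⟩ := hψ _ w π₀ hrr' hπ₀ hfs
  have hπ' := hfull _ w π₀ hrr' hπ₀ hfs
  set π' := ψ (Function.update r i r') w π₀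
  obtain ⟨l, hl⟩ := exists_multiplier_of_maximizer hd1 hfs hπ hmodel hmax
  obtain ⟨l', hl'⟩ := exists_multiplier_of_maximizer hd1 hfs hπ' hmodel' hmax'
  choose ξ hξpos hξdist hξ using fun x =>
    exists_slope_eq_of_hasDerivAt hd2 (hy x) (div_pos (hπ' x) (hfs x))
  set b : X → ℝ := fun x => π₀ x / f'' (ξ x) with hbdef
  have hb : ∀ x, 0 < b x := fun x => div_pos (hfs x) (hf''pos _ (hξpos x))
  have hdiff : ∀ x, π' x - π x = b x * (w i * ε * d x - (l' - l)) := by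
    intro x
    have h := hξ x
    rw [hl, hl', hr'def, socialReward_update r w i fun z => ε * d z] at h
    have h1 := (hf''pos _ (hξpos x)).ne'
    have h2 := (hfs x).ne'
    have h3 : w i * ε * d x - (l' - l) = f'' (ξ x) * (π' x / π₀ x - π x / π₀ x) := by
      rw [← h]; ring
    rw [h3, hbdef]
    field_simp
  have hsum : ∑ x, b x * (w i * ε * d x - (l' - l)) = 0 := by
    simp only [← hdiff, Finset.sum_sub_distrib, hmodel.2, hmodel'.2, sub_self]
  have hc : 0 < w i * ε := mul_pos hw0 hε
  have hm := abs_le_of_sum_mul_sub_eq_zero hb hc.le hdabs hsum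
  have hclose : dist ξ (fun x => π x / π₀ x) < δ := by
    refine (dist_pi_lt_iff hδ).2 fun x => ((hξdist x).trans ?_).trans_lt hεδ
    have hnum : |w i * ε * d x - (l' - l)| ≤ 2 * (w i * ε) := by
      have h1 : |w i * ε * d x| ≤ w i * ε := by
        rw [abs_mul, abs_of_pos hc]
        exact mul_le_of_le_one_right hc.le (hdabs x)
      linarith [abs_sub (w i * ε * d x) (l' - l)]
    have heq : π' x / π₀ x - π x / π₀ x = (w i * ε * d x - (l' - l)) / f'' (ξ x) := by
      rw [← sub_div, hdiff, hbdef]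
      have := (hfs x).ne'
      field_simp
    rw [heq, abs_div, abs_of_pos (hf''pos _ (hξpos x))]
    exact div_le_div₀ (by positivity) hnum hα (hstrong _ (hξpos x))
  obtain ⟨htξ, hltξ⟩ := hball hclose
  have hb₁₂ : b x₂ < b x₁ := by
    have h := one_div_lt_one_div_of_lt (div_pos (hf''pos _ (hξpos x₁)) (hfs x₁)) hltξ
    simpa only [one_div_div] using h
  have hpos := sum_mul_response_pos (ρ := r i) hb hc hle hb₁₂
    (by simpa only [hbdef, mul_div_assoc] using htξ) hsum
  have hval : valuation π' (r i) - valuation π (r i) =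
      ∑ x, b x * (w i * ε * d x - (l' - l)) * r i x := by
    simp only [valuation, ← hdiff, sub_mul, Finset.sum_sub_distrib]
  exact sub_pos.1 (hval ▸ hpos)
end
end

section
/- For any SW-Max training rule ψ, the mechanism (ψ, p^AFF) with the affine maximizer payment is individually rational and its payments are non-negative: for every group i, every profile (r⃗, w⃗) of truthfully reported reward models and sizes, and every full-support initial model π₀, w_i·v(ψ(r⃗, w⃗, π₀); r_i) − p^AFF_i(r⃗, w⃗, π₀) ≥ 0 and p^AFF_i(r⃗, w⃗, π₀) ≥ 0. -/
open Finset

noncomputable section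

variable {X : Type*}

/-- The affine social welfare excluding group `i`'s contribution. -/
def ASWminus [Fintype X] (f : ℝ → ℝ) {n : ℕ} (r : Fin n → X → ℝ) (w : Fin n → ℕ)
    (i : Fin n) (π π₀ : X → ℝ) : ℝ :=
  ASW f r w π π₀ - (w i : ℝ) * valuation π (r i)

/-- The affine maximizer payment.  The profile with group `i` removed is encoded by
setting group `i`'s weight to `0`. -/
def pAFF [Fintype X] (f : ℝ → ℝ) {n : ℕ}
    (ψ : (Fin n → X → ℝ) → (Fin n → ℕ) → (X → ℝ) → (X → ℝ))
    (r : Fin n → X → ℝ) (w : Fin n → ℕ) (π₀ : X → ℝ) (i : Fin n) : ℝ :=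
  ASWminus f r w i (ψ r (Function.update w i 0) π₀) π₀ -
    ASWminus f r w i (ψ r w π₀) π₀

/-- The affine social welfare excluding group `i` is the affine social welfare of the
profile in which group `i` has weight zero. -/
theorem ASW_update_zero [Fintype X] (f : ℝ → ℝ) {n : ℕ} (r : Fin n → X → ℝ) (w : Fin n → ℕ)
    (i : Fin n) (π π₀ : X → ℝ) :
    ASW f r (Function.update w i 0) π π₀ = ASWminus f r w i π π₀ := by
  have h : ∑ j ∈ univ.erase i, (Function.update w i 0 j : ℝ) * valuation π (r j) =
      ∑ j ∈ univ.erase i, (w j : ℝ) * valuation π (r j) :=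
    sum_congr rfl fun j hj => by rw [Function.update_of_ne (ne_of_mem_erase hj)]
  unfold ASWminus ASW
  rw [← add_sum_erase univ _ (mem_univ i), h,
    ← add_sum_erase univ (fun j => (w j : ℝ) * valuation π (r j)) (mem_univ i)]
  simp only [Function.update_self, Nat.cast_zero]
  ring

theorem valuation_nonneg [Fintype X] {π r : X → ℝ} (hπ : ∀ x, 0 ≤ π x) (hr : ∀ x, 0 ≤ r x) :
    0 ≤ valuation π r :=
  sum_nonneg fun x _ => mul_nonneg (hπ x) (hr x)

/-- the mechanism `(ψ, pAFF)` is individually rational and its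
payments are non-negative, for every SW-Max training rule `ψ`. -/
theorem swmax_pAFF_ir_nonneg
    [Fintype X] [Nonempty X] {n : ℕ} (f : ℝ → ℝ)
    (hconv : ConvexOn ℝ (Set.Ioi 0) f) (hf1 : f 1 = 0)
    (Rdom : (X → ℝ) → Prop)
    (hdom : Rdom = (IsRewardSum (X := X)) ∨ Rdom = (IsRewardMax (X := X)))
    (ψ : (Fin n → X → ℝ) → (Fin n → ℕ) → (X → ℝ) → (X → ℝ))
    (hψ : SWMaxRule f Rdom ψ)
    (i : Fin n) (r : Fin n → X → ℝ) (w : Fin n → ℕ)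
    (hr : ∀ j, Rdom (r j)) (hw : ∀ j, 1 ≤ w j)
    (π₀ : X → ℝ) (hπ₀ : IsModel π₀) (hfs : FullSupport π₀) :
    (w i : ℝ) * valuation (ψ r w π₀) (r i) - pAFF f ψ r w π₀ i ≥ 0 ∧
      0 ≤ pAFF f ψ r w π₀ i := by
  have hri : ∀ x, 0 ≤ r i x := by
    rcases hdom with rfl | rfl <;> exact (hr i).1
  obtain ⟨-, hmax⟩ := hψ r w π₀ hr hπ₀ hfs
  obtain ⟨hmodel', hmax'⟩ := hψ r (Function.update w i 0) π₀ hr hπ₀ hfs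
  have hval : 0 ≤ (w i : ℝ) * valuation (ψ r (Function.update w i 0) π₀) (r i) :=
    mul_nonneg (Nat.cast_nonneg _) (valuation_nonneg hmodel'.1 hri)
  refine ⟨?_, ?_⟩
  · have h := hmax _ hmodel'
    unfold pAFF ASWminus
    linarith
  · have h := hmax' _ (hψ r w π₀ hr hπ₀ hfs).1
    rw [ASW_update_zero, ASW_update_zero] at h
    exact sub_nonneg.2 h
end
end

section
/- Suppose all group sizes are fixed to 1 and are public information, so each group reports only its reward model, and the reward-model domain of each group is the set of all nonnegative reward models on X normalized by summation (respectively, by maximum), which is a connected subset of Euclidean space ℝ^X. Then every implementable training rule ψ (a function from reward-model profiles and initial models to models for which some payment rule makes the mechanism DSIC) satisfies payment equivalence: for any two payment rules p, p' implementing ψ in DSIC and each group i, there is a function g_i of (r⃗_{-i}, π₀) alone with p'_i(r⃗, π₀) = p_i(r⃗, π₀) + g_i(r⃗_{-i}, π₀) for all reported r_i. -/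
open Finset

noncomputable section

variable {X : Type*}

/-- DSIC for training rules without reported sizes (all group sizes fixed to 1). -/
def DSIC1 [Fintype X] {n : ℕ} (Rdom : (X → ℝ) → Prop)
    (ψ : (Fin n → X → ℝ) → (X → ℝ) → (X → ℝ))
    (p : (Fin n → X → ℝ) → (X → ℝ) → Fin n → ℝ) : Prop :=
  ∀ (r : Fin n → X → ℝ) (i : Fin n) (r' : X → ℝ) (π₀ : X → ℝ),
    (∀ j, Rdom (r j)) → Rdom r' → IsModel π₀ → FullSupport π₀ →
    valuation (ψ r π₀) (r i) - p r π₀ i ≥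
      valuation (ψ (Function.update r i r') π₀) (r i) -
        p (Function.update r i r') π₀ i

/-- A function on a star-convex set whose increments are dominated by the increments of a
vector field paired with the displacement is constant. -/
theorem StarConvex.eq_of_abs_sub_le_dotProduct [Fintype X] {T : Set (X → ℝ)} {c t : X → ℝ}
    (hT : StarConvex ℝ c T) (ht : t ∈ T) (D : (X → ℝ) → ℝ)
    (A : (X → ℝ) → X → ℝ)
    (h : ∀ s ∈ T, ∀ u ∈ T, |D u - D s| ≤ (A u - A s) ⬝ᵥ (u - s)) :
    D t = D c := by
  have subdivide (N : ℕ) : (N + 1 : ℝ) * |D t - D c| ≤ (A t - A c) ⬝ᵥ (t - c) := by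
    have hN : (0 : ℝ) < N + 1 := by positivity
    set γ : ℕ → X → ℝ := fun k => c + ((k : ℝ) / (N + 1)) • (t - c) with hγ
    have γ_zero : γ 0 = c := by simp [hγ]
    have γ_last : γ (N + 1) = t := by
      simp only [hγ, Nat.cast_add, Nat.cast_one, div_self hN.ne', one_smul]
      abel
    have γ_mem (k : ℕ) (hk : k ≤ N + 1) : γ k ∈ T := by
      refine hT.add_smul_sub_mem ht (by positivity) ?_
      rw [div_le_one hN]
      exact_mod_cast hk
    have γ_step (k : ℕ) : γ (k + 1) - γ k = (1 / (N + 1 : ℝ)) • (t - c) := by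
      simp only [hγ, add_sub_add_left_eq_sub, ← sub_smul]
      congr 1
      push_cast
      ring
    have bound (k : ℕ) (hk : k ≤ N + 1) :
        (N + 1 : ℝ) * |D (γ k) - D c| ≤ (A (γ k) - A c) ⬝ᵥ (t - c) := by
      induction k with
      | zero => simp [γ_zero]
      | succ k ih =>
        have hstep := h _ (γ_mem k (by omega)) _ (γ_mem (k + 1) hk)
        rw [γ_step, dotProduct_smul, smul_eq_mul, one_div, inv_mul_eq_div,
          le_div_iff₀' hN] at hstep
        calc (N + 1 : ℝ) * |D (γ (k + 1)) - D c|
            ≤ (N + 1 : ℝ) * (|D (γ (k + 1)) - D (γ k)| + |D (γ k) - D c|) := by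
              gcongr
              exact abs_sub_le _ _ _
          _ ≤ (A (γ (k + 1)) - A (γ k)) ⬝ᵥ (t - c) + (A (γ k) - A c) ⬝ᵥ (t - c) := by
              rw [mul_add]
              exact add_le_add hstep (ih (by omega))
          _ = (A (γ (k + 1)) - A c) ⬝ᵥ (t - c) := by
              rw [← add_dotProduct, sub_add_sub_cancel]
    simpa only [γ_last] using bound (N + 1) le_rfl
  by_contra hne
  have hpos : 0 < |D t - D c| := abs_pos.mpr (sub_ne_zero.mpr hne)
  obtain ⟨N, hN⟩ := exists_nat_gt (((A t - A c) ⬝ᵥ (t - c)) / |D t - D c|)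
  rw [div_lt_iff₀ hpos] at hN
  linarith [subdivide N]

/-- The reward models normalized by summation form the standard simplex, which is convex. -/
theorem exists_starConvex_isRewardSum [Fintype X] [Nonempty X] :
    ∃ c, StarConvex ℝ c {r : X → ℝ | IsRewardSum r} := by
  classical
  obtain ⟨x⟩ := ‹Nonempty X›
  have hx : Pi.single x 1 ∈ stdSimplex ℝ X := single_mem_stdSimplex ℝ x
  exact ⟨_, (convex_stdSimplex ℝ X).starConvex hx⟩

/-- The reward models normalized by maximum are star-convex about the constant model `1`. -/
theorem exists_starConvex_isRewardMax :
    ∃ c, StarConvex ℝ c {r : X → ℝ | IsRewardMax r} := by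
  refine ⟨1, ?_⟩
  rintro r ⟨h0, h1, x, hx⟩ a b ha hb hab
  refine ⟨fun y => ?_, fun y => ?_, x, ?_⟩
  · have := mul_nonneg hb (h0 y)
    simp only [Pi.add_apply, Pi.smul_apply, Pi.one_apply, smul_eq_mul]
    linarith
  · have := mul_le_mul_of_nonneg_left (h1 y) hb
    simp only [Pi.add_apply, Pi.smul_apply, Pi.one_apply, smul_eq_mul]
    linarith
  · simpa [hx] using hab

/-- Under DSIC, the difference of two payments cannot change faster than monotonicity of
the training rule allows. -/
theorem DSIC1.abs_payment_diff_le [Fintype X] {n : ℕ} {Rdom : (X → ℝ) → Prop}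
    {ψ : (Fin n → X → ℝ) → (X → ℝ) → (X → ℝ)}
    {p p' : (Fin n → X → ℝ) → (X → ℝ) → Fin n → ℝ}
    (hp : DSIC1 Rdom ψ p) (hp' : DSIC1 Rdom ψ p') {r : Fin n → X → ℝ} {π₀ : X → ℝ}
    (hr : ∀ j, Rdom (r j)) (hπ : IsModel π₀) (hπ' : FullSupport π₀) (i : Fin n)
    {s t : X → ℝ} (hs : Rdom s) (ht : Rdom t) :
    |(p' (Function.update r i t) π₀ i - p (Function.update r i t) π₀ i) -
      (p' (Function.update r i s) π₀ i - p (Function.update r i s) π₀ i)| ≤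
      (ψ (Function.update r i t) π₀ - ψ (Function.update r i s) π₀) ⬝ᵥ (t - s) := by
  have dom {u : X → ℝ} (hu : Rdom u) (j : Fin n) : Rdom (Function.update r i u j) := by
    rcases eq_or_ne j i with rfl | hj
    · simpa using hu
    · simpa [hj] using hr j
  have h₁ := hp _ i s π₀ (dom ht) hs hπ hπ'
  have h₂ := hp _ i t π₀ (dom hs) ht hπ hπ'
  have h₃ := hp' _ i s π₀ (dom ht) hs hπ hπ'
  have h₄ := hp' _ i t π₀ (dom hs) ht hπ hπ'
  simp only [Function.update_idem, Function.update_self] at h₁ h₂ h₃ h₄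
  have valuation_eq (π u : X → ℝ) : valuation π u = π ⬝ᵥ u := rfl
  simp only [valuation_eq] at h₁ h₂ h₃ h₄
  rw [sub_dotProduct, dotProduct_sub, dotProduct_sub, abs_le]
  constructor <;> linarith

/-- when all group sizes are fixed to 1, every implementable training
rule satisfies payment equivalence. -/
theorem implementable_payment_equivalence_unit_sizes
    [Fintype X] [Nonempty X] {n : ℕ}
    (Rdom : (X → ℝ) → Prop)
    (hdom : Rdom = (IsRewardSum (X := X)) ∨ Rdom = (IsRewardMax (X := X)))
    (ψ : (Fin n → X → ℝ) → (X → ℝ) → (X → ℝ))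
    (hmodel : ∀ (r : Fin n → X → ℝ) (π₀ : X → ℝ),
      (∀ j, Rdom (r j)) → IsModel π₀ → FullSupport π₀ → IsModel (ψ r π₀))
    (himpl : ∃ p, DSIC1 Rdom ψ p)
    (p p' : (Fin n → X → ℝ) → (X → ℝ) → Fin n → ℝ)
    (hp : DSIC1 Rdom ψ p) (hp' : DSIC1 Rdom ψ p')
    (i : Fin n) :
    ∃ g : (Fin n → X → ℝ) → (X → ℝ) → ℝ,
      (∀ (r : Fin n → X → ℝ) (r₁ r₂ : X → ℝ) (π₀ : X → ℝ),
        g (Function.update r i r₁) π₀ = g (Function.update r i r₂) π₀) ∧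
      ∀ (r : Fin n → X → ℝ) (π₀ : X → ℝ),
        (∀ j, Rdom (r j)) → IsModel π₀ → FullSupport π₀ →
        p' r π₀ i = p r π₀ i + g r π₀ := by
  obtain ⟨c, hstar⟩ : ∃ c, StarConvex ℝ c {r | Rdom r} := by
    rcases hdom with rfl | rfl
    · exact exists_starConvex_isRewardSum
    · exact exists_starConvex_isRewardMax
  refine ⟨fun r π₀ => p' (Function.update r i c) π₀ i - p (Function.update r i c) π₀ i,
    fun r r₁ r₂ π₀ => by simp only [Function.update_idem], fun r π₀ hr hπ hπ' => ?_⟩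
  have key := hstar.eq_of_abs_sub_le_dotProduct (hr i)
    (fun u => p' (Function.update r i u) π₀ i - p (Function.update r i u) π₀ i)
    (fun u => ψ (Function.update r i u) π₀)
    (fun s hs u hu => hp.abs_payment_diff_le hp' hr hπ hπ' i hs hu)
  simp only [Function.update_eq_self] at key
  linarith
end
end

section
/- The SW-Max training rule with KL-divergence regularization, i.e. with f(y) = λ·y·log y for a constant λ > 0, is continuous: for every δ > 0, if two profiles (r⃗, w⃗) and (r⃗', w⃗') satisfy max_{x∈X} |Σ_{i=1}^n w_i r_i(x) − Σ_{i=1}^n w'_i r'_i(x)| ≤ min{(λ/2)·log(1/(1−δ)), (λ/2)·log(1+δ)}, then the corresponding maximizers π = ψ(r⃗, w⃗, π₀) and π' = ψ(r⃗', w⃗', π₀) satisfy max_{x∈X} |π(x) − π'(x)| ≤ δ for every full-support initial model π₀. In particular, for every ε > 0 there exists δ' > 0 such that max_{x∈X} |Σ_i w_i r_i(x) − Σ_i w'_i r'_i(x)| ≤ δ' implies max_{x∈X} |π(x) − π'(x)| ≤ ε. -/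
open Finset

noncomputable section

variable {X : Type*}

/-- The Gibbs distribution obtained by tilting `π₀` by `exp u`. -/
def gibbs [Fintype X] (π₀ u : X → ℝ) (x : X) : ℝ :=
  π₀ x * Real.exp (u x) / ∑ y, π₀ y * Real.exp (u y)

theorem partition_pos [Fintype X] [Nonempty X] {π₀ : X → ℝ} (h₀ : FullSupport π₀) (u : X → ℝ) :
    0 < ∑ y, π₀ y * Real.exp (u y) :=
  Finset.sum_pos (fun y _ => mul_pos (h₀ y) (Real.exp_pos _)) Finset.univ_nonempty

theorem gibbs_pos [Fintype X] [Nonempty X] {π₀ : X → ℝ} (h₀ : FullSupport π₀) (u : X → ℝ) (x : X) :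
    0 < gibbs π₀ u x :=
  div_pos (mul_pos (h₀ x) (Real.exp_pos _)) (partition_pos h₀ u)

theorem sum_gibbs [Fintype X] [Nonempty X] {π₀ : X → ℝ} (h₀ : FullSupport π₀) (u : X → ℝ) :
    ∑ x, gibbs π₀ u x = 1 := by
  unfold gibbs
  rw [← Finset.sum_div, div_self (partition_pos h₀ u).ne']

theorem isModel_gibbs [Fintype X] [Nonempty X] {π₀ : X → ℝ} (h₀ : FullSupport π₀) (u : X → ℝ) :
    IsModel (gibbs π₀ u) :=
  ⟨fun x => (gibbs_pos h₀ u x).le, sum_gibbs h₀ u⟩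

theorem gibbs_mul_klFun [Fintype X] [Nonempty X] {π₀ : X → ℝ} (h₀ : FullSupport π₀) (u : X → ℝ)
    {p : ℝ} (hp : 0 ≤ p) (x : X) :
    gibbs π₀ u x * InformationTheory.klFun (p / gibbs π₀ u x) =
      π₀ x * (p / π₀ x * Real.log (p / π₀ x)) - p * u x
        + p * Real.log (∑ y, π₀ y * Real.exp (u y)) + gibbs π₀ u x - p := by
  have hg := gibbs_pos h₀ u x
  have hx := h₀ x
  rcases hp.eq_or_lt with rfl | hp
  · simp [InformationTheory.klFun]
  · have hlog : Real.log (p / gibbs π₀ u x) =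
        Real.log (p / π₀ x) - u x + Real.log (∑ y, π₀ y * Real.exp (u y)) := by
      rw [Real.log_div hp.ne' hg.ne', Real.log_div hp.ne' hx.ne', gibbs,
        Real.log_div (mul_pos hx (Real.exp_pos _)).ne' (partition_pos h₀ u).ne',
        Real.log_mul hx.ne' (Real.exp_pos _).ne', Real.log_exp]
      ring
    rw [InformationTheory.klFun, hlog]
    field_simp

theorem sum_mul_valuation [Fintype X] {n : ℕ} (r : Fin n → X → ℝ) (w : Fin n → ℕ) (π : X → ℝ) :
    ∑ i, (w i : ℝ) * valuation π (r i) = ∑ x, π x * ∑ i, (w i : ℝ) * r i x := by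
  simp only [valuation, Finset.mul_sum]
  rw [Finset.sum_comm]
  exact Finset.sum_congr rfl fun x _ => Finset.sum_congr rfl fun i _ => by ring

/-- The KL-regularized welfare is, up to a constant, minus the divergence from the Gibbs
distribution. -/
theorem ASW_kl_eq [Fintype X] [Nonempty X] {n : ℕ} {lam : ℝ} (hlam : 0 < lam)
    (r : Fin n → X → ℝ) (w : Fin n → ℕ) {π π₀ : X → ℝ} (hπ : IsModel π) (h₀ : FullSupport π₀) :
    ASW (fun y => lam * (y * Real.log y)) r w π π₀ =
      lam * (Real.log (∑ y, π₀ y * Real.exp ((∑ i, (w i : ℝ) * r i y) / lam)) -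
        ∑ x, gibbs π₀ (fun y => (∑ i, (w i : ℝ) * r i y) / lam) x * InformationTheory.klFun
          (π x / gibbs π₀ (fun y => (∑ i, (w i : ℝ) * r i y) / lam) x)) := by
  simp only [fun x => gibbs_mul_klFun h₀ (fun y => (∑ i, (w i : ℝ) * r i y) / lam) (hπ.1 x) x]
  simp only [Finset.sum_sub_distrib, Finset.sum_add_distrib, ← Finset.sum_mul, sum_gibbs h₀, hπ.2]
  have hu : ∑ x, π x * ((∑ i, (w i : ℝ) * r i x) / lam) =
      (∑ x, π x * ∑ i, (w i : ℝ) * r i x) / lam := by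
    rw [Finset.sum_div]
    exact Finset.sum_congr rfl fun x _ => by ring
  have hf : fDiv (fun y => lam * (y * Real.log y)) π π₀ =
      lam * ∑ x, π₀ x * (π x / π₀ x * Real.log (π x / π₀ x)) := by
    rw [fDiv, Finset.mul_sum]
    exact Finset.sum_congr rfl fun x _ => by ring
  rw [ASW, sum_mul_valuation, hf, hu]
  field_simp
  ring

theorem eq_gibbs_of_ASW_max [Fintype X] [Nonempty X] {n : ℕ} {lam : ℝ} (hlam : 0 < lam)
    (r : Fin n → X → ℝ) (w : Fin n → ℕ) {π π₀ : X → ℝ} (hπ : IsModel π) (h₀ : FullSupport π₀)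
    (hmax : ∀ π' : X → ℝ, IsModel π' → ASW (fun y => lam * (y * Real.log y)) r w π' π₀ ≤
      ASW (fun y => lam * (y * Real.log y)) r w π π₀) :
    π = gibbs π₀ fun y => (∑ i, (w i : ℝ) * r i y) / lam := by
  set g := gibbs π₀ fun y => (∑ i, (w i : ℝ) * r i y) / lam with hgdef
  have hg : ∀ x, 0 < g x := gibbs_pos h₀ _
  have hgm : IsModel g := isModel_gibbs h₀ _
  have hle := hmax g hgm
  rw [ASW_kl_eq hlam r w hgm h₀, ASW_kl_eq hlam r w hπ h₀, mul_le_mul_iff_right₀ hlam,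
    ← hgdef] at hle
  have hself : ∑ x, g x * InformationTheory.klFun (g x / g x) = 0 :=
    Finset.sum_eq_zero fun x _ => by
      rw [div_self (hg x).ne', InformationTheory.klFun_one, mul_zero]
  have hnonneg : ∀ x ∈ Finset.univ, 0 ≤ g x * InformationTheory.klFun (π x / g x) := fun x _ =>
    mul_nonneg (hg x).le (InformationTheory.klFun_nonneg (div_nonneg (hπ.1 x) (hg x).le))
  have hzero : ∑ x, g x * InformationTheory.klFun (π x / g x) = 0 :=
    le_antisymm (by linarith) (Finset.sum_nonneg hnonneg)
  funext x
  have hx := (Finset.sum_eq_zero_iff_of_nonneg hnonneg).1 hzero x (Finset.mem_univ x)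
  have hkl := (mul_eq_zero.1 hx).resolve_left (hg x).ne'
  rw [InformationTheory.klFun_eq_zero_iff (div_nonneg (hπ.1 x) (hg x).le)] at hkl
  exact (div_eq_one_iff_eq (hg x).ne').1 hkl

theorem gibbs_le_exp_mul_gibbs [Fintype X] [Nonempty X] {π₀ : X → ℝ} (h₀ : FullSupport π₀)
    {u v : X → ℝ} {c : ℝ} (h : ∀ x, |u x - v x| ≤ c) (x : X) :
    gibbs π₀ u x ≤ Real.exp (2 * c) * gibbs π₀ v x := by
  have tilt : ∀ {a b : X → ℝ}, (∀ y, a y - b y ≤ c) → ∀ y,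
      π₀ y * Real.exp (a y) ≤ Real.exp c * (π₀ y * Real.exp (b y)) := fun {a b} hab y => by
    rw [mul_left_comm, ← Real.exp_add]
    exact mul_le_mul_of_nonneg_left (Real.exp_le_exp.2 (by linarith [hab y])) (h₀ y).le
  have hnum := tilt (fun y => (abs_le.1 (h y)).2) x
  have hden : ∑ y, π₀ y * Real.exp (v y) ≤ Real.exp c * ∑ y, π₀ y * Real.exp (u y) := by
    rw [Finset.mul_sum]
    exact Finset.sum_le_sum fun y _ => tilt (fun y => by linarith [(abs_le.1 (h y)).1]) y
  rw [gibbs, gibbs, ← mul_div_assoc, div_le_div_iff₀ (partition_pos h₀ u) (partition_pos h₀ v)]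
  calc _ ≤ Real.exp c * (π₀ x * Real.exp (v x)) * (Real.exp c * ∑ y, π₀ y * Real.exp (u y)) :=
        mul_le_mul hnum hden (partition_pos h₀ v).le
          (mul_pos (Real.exp_pos _) (mul_pos (h₀ x) (Real.exp_pos _))).le
    _ = _ := by rw [two_mul, Real.exp_add]; ring

theorem abs_gibbs_sub_le [Fintype X] [Nonempty X] {π₀ : X → ℝ} (h₀ : FullSupport π₀)
    {u v : X → ℝ} {δ : ℝ} (hδ : 0 < δ) (h : ∀ x, |u x - v x| ≤ Real.log (1 + δ) / 2) (x : X) :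
    |gibbs π₀ u x - gibbs π₀ v x| ≤ δ := by
  have hexp : Real.exp (2 * (Real.log (1 + δ) / 2)) = 1 + δ := by
    rw [mul_div_cancel₀ _ two_ne_zero, Real.exp_log (by linarith)]
  have le_one : ∀ a : X → ℝ, gibbs π₀ a x ≤ 1 := fun a =>
    sum_gibbs h₀ a ▸ Finset.single_le_sum (fun y _ => (gibbs_pos h₀ a y).le) (Finset.mem_univ x)
  have huv := gibbs_le_exp_mul_gibbs h₀ h x
  have hvu := gibbs_le_exp_mul_gibbs h₀ (fun y => (abs_sub_comm (v y) (u y)).trans_le (h y)) x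
  rw [hexp] at huv hvu
  rw [abs_le]
  constructor <;> nlinarith [le_one u, le_one v]

theorem SWMaxRule.abs_sub_le [Fintype X] [Nonempty X] {n : ℕ} {lam : ℝ} (hlam : 0 < lam)
    {Rdom : (X → ℝ) → Prop} {ψ : (Fin n → X → ℝ) → (Fin n → ℕ) → (X → ℝ) → (X → ℝ)}
    (hψ : SWMaxRule (fun y => lam * (y * Real.log y)) Rdom ψ) {δ : ℝ} (hδ : 0 < δ)
    {r r' : Fin n → X → ℝ} {w w' : Fin n → ℕ} {π₀ : X → ℝ}
    (hr : ∀ j, Rdom (r j)) (hr' : ∀ j, Rdom (r' j)) (hm : IsModel π₀) (h₀ : FullSupport π₀)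
    (h : ∀ x, |∑ i, (w i : ℝ) * r i x - ∑ i, (w' i : ℝ) * r' i x| ≤
      lam / 2 * Real.log (1 + δ)) (x : X) :
    |ψ r w π₀ x - ψ r' w' π₀ x| ≤ δ := by
  obtain ⟨hπ, hmax⟩ := hψ r w π₀ hr hm h₀
  obtain ⟨hπ', hmax'⟩ := hψ r' w' π₀ hr' hm h₀
  rw [eq_gibbs_of_ASW_max hlam r w hπ h₀ hmax, eq_gibbs_of_ASW_max hlam r' w' hπ' h₀ hmax']
  refine abs_gibbs_sub_le h₀ hδ (fun y => ?_) x
  rw [← sub_div, abs_div, abs_of_pos hlam, div_le_iff₀ hlam]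
  linarith [h y]

/-- continuity of the SW-Max rule with KL-divergence regularization
`f y = λ · y · log y`, with the explicit modulus, and the ε-δ consequence. -/
theorem swmax_kl_continuous
    [Fintype X] [Nonempty X] {n : ℕ} (lam : ℝ) (hlam : 0 < lam)
    (Rdom : (X → ℝ) → Prop)
    (hdom : Rdom = (IsRewardSum (X := X)) ∨ Rdom = (IsRewardMax (X := X)))
    (ψ : (Fin n → X → ℝ) → (Fin n → ℕ) → (X → ℝ) → (X → ℝ))
    (hψ : SWMaxRule (fun y => lam * (y * Real.log y)) Rdom ψ) :
    (∀ δ : ℝ, 0 < δ →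
      ∀ (r r' : Fin n → X → ℝ) (w w' : Fin n → ℕ) (π₀ : X → ℝ),
        (∀ j, Rdom (r j)) → (∀ j, Rdom (r' j)) →
        (∀ j, 1 ≤ w j) → (∀ j, 1 ≤ w' j) →
        IsModel π₀ → FullSupport π₀ →
        (∀ x, |∑ i, (w i : ℝ) * r i x - ∑ i, (w' i : ℝ) * r' i x| ≤
          min (lam / 2 * Real.log (1 / (1 - δ))) (lam / 2 * Real.log (1 + δ))) →
        ∀ x, |ψ r w π₀ x - ψ r' w' π₀ x| ≤ δ) ∧
    (∀ ε : ℝ, 0 < ε → ∃ δ' : ℝ, 0 < δ' ∧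
      ∀ (r r' : Fin n → X → ℝ) (w w' : Fin n → ℕ) (π₀ : X → ℝ),
        (∀ j, Rdom (r j)) → (∀ j, Rdom (r' j)) →
        (∀ j, 1 ≤ w j) → (∀ j, 1 ≤ w' j) →
        IsModel π₀ → FullSupport π₀ →
        (∀ x, |∑ i, (w i : ℝ) * r i x - ∑ i, (w' i : ℝ) * r' i x| ≤ δ') →
        ∀ x, |ψ r w π₀ x - ψ r' w' π₀ x| ≤ ε) := by
  refine ⟨fun δ hδ r r' w w' π₀ hr hr' _ _ hm h₀ h => ?_, fun ε hε =>
    ⟨lam / 2 * Real.log (1 + ε), mul_pos (half_pos hlam) (Real.log_pos (by linarith)), ?_⟩⟩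
  · exact hψ.abs_sub_le hlam hδ hr hr' hm h₀ fun x => (h x).trans (min_le_right _ _)
  · exact fun r r' w w' π₀ hr hr' _ _ hm h₀ h => hψ.abs_sub_le hlam hε hr hr' hm h₀ h
end
end

section
/- Let ψ be an implementable training rule whose input profiles consist of reward models r_i and integer sizes w_i ∈ W = {1, …, w̄}. If (i) ψ is continuous, and (ii) for every group i, every profile (r⃗_{-i}, w⃗_{-i}) of others' reports, and every full-support initial model π₀, there exist a reward model r*_i and a model π such that ψ((r*_i, r⃗_{-i}), (w_i, w⃗_{-i}), π₀) = π for every w_i ∈ W (in the maximum-normalization case r*_i is required to be the constant-1 reward model), then ψ satisfies payment equivalence: for any two payment rules p, p' implementing ψ in DSIC and each group i, there is a function g_i of (r⃗_{-i}, w⃗_{-i}, π₀) alone with p'_i(r⃗, w⃗, π₀) = p_i(r⃗, w⃗, π₀) + g_i(r⃗_{-i}, w⃗_{-i}, π₀) for all (r_i, w_i). -/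
open Finset

noncomputable section

variable {X : Type*}

/-- A payment rule `p` implements the training rule `ψ` in DSIC (on the domain where
reward models satisfy `Rdom` and sizes lie in `{1, …, wbar}`): truthful reporting
always yields utility at least that of any misreport, regardless of others' reports. -/
def DSICw [Fintype X] {n : ℕ} (Rdom : (X → ℝ) → Prop) (wbar : ℕ)
    (ψ : (Fin n → X → ℝ) → (Fin n → ℕ) → (X → ℝ) → (X → ℝ))
    (p : (Fin n → X → ℝ) → (Fin n → ℕ) → (X → ℝ) → Fin n → ℝ) : Prop :=
  ∀ (r : Fin n → X → ℝ) (w : Fin n → ℕ) (i : Fin n) (r' : X → ℝ) (w' : ℕ)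
    (π₀ : X → ℝ),
    (∀ j, Rdom (r j)) → (∀ j, 1 ≤ w j ∧ w j ≤ wbar) →
    Rdom r' → 1 ≤ w' → w' ≤ wbar →
    IsModel π₀ → FullSupport π₀ →
    (w i : ℝ) * valuation (ψ r w π₀) (r i) - p r w π₀ i ≥
      (w i : ℝ) *
          valuation (ψ (Function.update r i r') (Function.update w i w') π₀) (r i) -
        p (Function.update r i r') (Function.update w i w') π₀ i

/-- Continuity of a training rule: if the weighted aggregate reward functions of two
profiles are uniformly close, then the corresponding trained models are uniformly
close. -/
def ContinuousRule [Fintype X] {n : ℕ}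
    (ψ : (Fin n → X → ℝ) → (Fin n → ℕ) → (X → ℝ) → (X → ℝ)) : Prop :=
  ∀ ε : ℝ, 0 < ε → ∃ δ : ℝ, 0 < δ ∧
    ∀ (r r' : Fin n → X → ℝ) (w w' : Fin n → ℕ) (π₀ : X → ℝ),
      IsModel π₀ → FullSupport π₀ →
      (∀ x, |∑ i, (w i : ℝ) * r i x - ∑ i, (w' i : ℝ) * r' i x| ≤ δ) →
      ∀ x, |ψ r w π₀ x - ψ r' w' π₀ x| ≤ ε

open Function in
/-- The difference of two payment rules implementing the same training rule varies between two
reports of a group by at most the pairing of the change in its scaled reward with the change in the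
trained model. -/
theorem DSICw.abs_payment_sub_le [Fintype X] {n : ℕ} {Rdom : (X → ℝ) → Prop} {wbar : ℕ}
    {ψ : (Fin n → X → ℝ) → (Fin n → ℕ) → (X → ℝ) → (X → ℝ)}
    {p p' : (Fin n → X → ℝ) → (Fin n → ℕ) → (X → ℝ) → Fin n → ℝ}
    (hp : DSICw Rdom wbar ψ p) (hp' : DSICw Rdom wbar ψ p')
    {r : Fin n → X → ℝ} {w : Fin n → ℕ} {π₀ : X → ℝ} (i : Fin n)
    (hr : ∀ j, Rdom (r j)) (hw : ∀ j, 1 ≤ w j ∧ w j ≤ wbar)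
    (hπ : IsModel π₀) (hs : FullSupport π₀)
    {r₁ r₂ : X → ℝ} {w₁ w₂ : ℕ} (hr₁ : Rdom r₁) (hr₂ : Rdom r₂)
    (hw₁ : 1 ≤ w₁ ∧ w₁ ≤ wbar) (hw₂ : 1 ≤ w₂ ∧ w₂ ≤ wbar) :
    |(p' (update r i r₂) (update w i w₂) π₀ i - p (update r i r₂) (update w i w₂) π₀ i) -
      (p' (update r i r₁) (update w i w₁) π₀ i - p (update r i r₁) (update w i w₁) π₀ i)| ≤
    |∑ x, (w₂ * r₂ x - w₁ * r₁ x) *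
      (ψ (update r i r₂) (update w i w₂) π₀ x - ψ (update r i r₁) (update w i w₁) π₀ x)| := by
  have hru {s : X → ℝ} (h : Rdom s) : ∀ j, Rdom (update r i s j) :=
    (forall_update_iff r fun _ => Rdom).2 ⟨h, fun j _ => hr j⟩
  have hwu {m : ℕ} (h : 1 ≤ m ∧ m ≤ wbar) :
      ∀ j, 1 ≤ update w i m j ∧ update w i m j ≤ wbar :=
    (forall_update_iff w fun _ k => 1 ≤ k ∧ k ≤ wbar).2 ⟨h, fun j _ => hw j⟩
  have h₁ := hp _ _ i r₂ w₂ π₀ (hru hr₁) (hwu hw₁) hr₂ hw₂.1 hw₂.2 hπ hs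
  have h₂ := hp _ _ i r₁ w₁ π₀ (hru hr₂) (hwu hw₂) hr₁ hw₁.1 hw₁.2 hπ hs
  have h₁' := hp' _ _ i r₂ w₂ π₀ (hru hr₁) (hwu hw₁) hr₂ hw₂.1 hw₂.2 hπ hs
  have h₂' := hp' _ _ i r₁ w₁ π₀ (hru hr₂) (hwu hw₂) hr₁ hw₁.1 hw₁.2 hπ hs
  simp only [update_idem, update_self] at h₁ h₂ h₁' h₂'
  set A := ψ (update r i r₁) (update w i w₁) π₀
  set B := ψ (update r i r₂) (update w i w₂) π₀
  have key : ∑ x, (w₂ * r₂ x - w₁ * r₁ x) * (B x - A x) =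
      w₂ * valuation B r₂ - w₂ * valuation A r₂ - (w₁ * valuation B r₁ - w₁ * valuation A r₁) := by
    simp only [valuation, Finset.mul_sum, ← Finset.sum_sub_distrib]
    exact Finset.sum_congr rfl fun x _ => by ring
  rw [key]
  refine le_trans ?_ (le_abs_self _)
  rw [abs_le]
  constructor <;> linarith

/-- A function on the unit interval whose increments are uniformly `o(|s - t|)` has equal endpoint
values. -/
theorem eq_of_uniform_increment_le {h : ℝ → ℝ}
    (H : ∀ ε : ℝ, 0 < ε → ∃ δ : ℝ, 0 < δ ∧ ∀ s ∈ Set.Icc (0 : ℝ) 1, ∀ t ∈ Set.Icc (0 : ℝ) 1,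
      |t - s| ≤ δ → |h t - h s| ≤ ε * |t - s|) : h 1 = h 0 := by
  refine eq_of_abs_sub_le_all fun ε hε => ?_
  obtain ⟨δ, hδ, hinc⟩ := H ε hε
  obtain ⟨m, hm⟩ := exists_nat_one_div_lt hδ
  have hN : (0 : ℝ) < m + 1 := by positivity
  have htel : h 1 - h 0 =
      ∑ j ∈ Finset.range (m + 1), (h ((j + 1 : ℕ) / (m + 1)) - h (j / (m + 1))) := by
    rw [Finset.sum_range_sub fun j : ℕ => h (j / (m + 1))]
    simp [div_self hN.ne']
  have hstep : ∀ j ∈ Finset.range (m + 1),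
      |h ((j + 1 : ℕ) / (m + 1)) - h (j / (m + 1))| ≤ ε * (1 / (m + 1)) := by
    intro j hj
    have hj' : (j : ℝ) + 1 ≤ m + 1 := by exact_mod_cast Finset.mem_range.1 hj
    have hdiff : |((j + 1 : ℕ) : ℝ) / (m + 1) - j / (m + 1)| = 1 / (m + 1) := by
      rw [← sub_div, Nat.cast_succ, add_sub_cancel_left, abs_of_pos (by positivity)]
    refine (hinc _ ⟨by positivity, ?_⟩ _ ⟨by positivity, ?_⟩ ?_).trans_eq (by rw [hdiff])
    · rw [div_le_one hN]; linarith
    · rw [div_le_one hN]; push_cast; exact hj'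
    · rw [hdiff]; exact hm.le
  rw [htel]
  calc _ ≤ _ := Finset.abs_sum_le_sum_abs _ _
    _ ≤ _ := Finset.sum_le_sum hstep
    _ = ε := by simp; field_simp

theorem IsRewardSum.segment [Fintype X] {r s : X → ℝ} (hr : IsRewardSum r) (hs : IsRewardSum s)
    {t : ℝ} (ht : t ∈ Set.Icc (0 : ℝ) 1) : IsRewardSum fun x => r x + t * (s x - r x) := by
  refine ⟨fun x => ?_, ?_⟩
  · nlinarith [mul_nonneg ht.1 (hs.1 x), mul_nonneg (sub_nonneg.2 ht.2) (hr.1 x)]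
  · rw [Finset.sum_add_distrib, ← Finset.mul_sum, Finset.sum_sub_distrib, hr.2, hs.2]
    ring

theorem IsRewardMax.segment_one {r : X → ℝ} (hr : IsRewardMax r)
    {t : ℝ} (ht : t ∈ Set.Icc (0 : ℝ) 1) : IsRewardMax fun x => r x + t * (1 - r x) := by
  obtain ⟨h0, h1, x₀, hx₀⟩ := hr
  refine ⟨fun x => ?_, fun x => ?_, x₀, by simp [hx₀]⟩
  · nlinarith [mul_nonneg ht.1 (sub_nonneg.2 (h1 x)), h0 x]
  · nlinarith [mul_nonneg (sub_nonneg.2 ht.2) (sub_nonneg.2 (h1 x))]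

open Function in
/-- Two payment rules implementing a continuous training rule differ by the same amount at the two
endpoints of a segment of admissible reward models, the size being fixed. -/
theorem ContinuousRule.payment_sub_eq_of_segment [Fintype X] {n : ℕ} {Rdom : (X → ℝ) → Prop}
    {wbar : ℕ} {ψ : (Fin n → X → ℝ) → (Fin n → ℕ) → (X → ℝ) → (X → ℝ)}
    {p p' : (Fin n → X → ℝ) → (Fin n → ℕ) → (X → ℝ) → Fin n → ℝ} (hcont : ContinuousRule ψ)
    (hp : DSICw Rdom wbar ψ p) (hp' : DSICw Rdom wbar ψ p')
    {r : Fin n → X → ℝ} {w : Fin n → ℕ} {π₀ : X → ℝ} (i : Fin n)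
    (hr : ∀ j, Rdom (r j)) (hw : ∀ j, 1 ≤ w j ∧ w j ≤ wbar)
    (hπ : IsModel π₀) (hs : FullSupport π₀) {r₁ r₂ : X → ℝ} {k : ℕ} (hk : 1 ≤ k ∧ k ≤ wbar)
    (hseg : ∀ t ∈ Set.Icc (0 : ℝ) 1, Rdom fun x => r₁ x + t * (r₂ x - r₁ x)) :
    p' (update r i r₂) (update w i k) π₀ i - p (update r i r₂) (update w i k) π₀ i =
      p' (update r i r₁) (update w i k) π₀ i - p (update r i r₁) (update w i k) π₀ i := by
  let ρ : ℝ → X → ℝ := fun t x => r₁ x + t * (r₂ x - r₁ x)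
  have h0 : ρ 0 = r₁ := by ext; simp [ρ]
  have h1 : ρ 1 = r₂ := by ext; simp [ρ]
  have := eq_of_uniform_increment_le (h := fun t =>
    p' (update r i (ρ t)) (update w i k) π₀ i - p (update r i (ρ t)) (update w i k) π₀ i) ?_
  · simpa only [h0, h1] using this
  intro ε hε
  set C : ℝ := ∑ x, |k * (r₂ x - r₁ x)|
  have hC0 : 0 ≤ C := Finset.sum_nonneg fun x _ => abs_nonneg _
  have hC1 : 0 < C + 1 := by linarith
  obtain ⟨δ, hδ, hψ⟩ := hcont (ε / (C + 1)) (by positivity)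
  refine ⟨δ / (C + 1), by positivity, fun s hs' t ht hst => ?_⟩
  have hinc (x : X) : (k : ℝ) * ρ t x - k * ρ s x = (t - s) * (k * (r₂ x - r₁ x)) := by
    simp only [ρ]; ring
  have hagg (x : X) : |∑ j, ((update w i k j : ℕ) : ℝ) * update r i (ρ t) j x -
      ∑ j, ((update w i k j : ℕ) : ℝ) * update r i (ρ s) j x| ≤ δ := by
    rw [← Finset.sum_sub_distrib, Finset.sum_eq_single i
      (fun j _ hj => by simp [hj]) (by simp)]
    simp only [update_self]
    rw [hinc, abs_mul]
    calc _ ≤ δ / (C + 1) * (C + 1) := mul_le_mul hst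
          ((Finset.single_le_sum (f := fun x => |(k : ℝ) * (r₂ x - r₁ x)|)
            (fun x _ => abs_nonneg _) (Finset.mem_univ x)).trans (by linarith))
          (abs_nonneg _) (by positivity)
      _ = δ := by field_simp
  have hclose := hψ _ _ _ _ π₀ hπ hs hagg
  refine (hp.abs_payment_sub_le hp' i hr hw hπ hs (hseg s hs') (hseg t ht) hk hk).trans ?_
  calc _ ≤ ∑ x, |t - s| * |k * (r₂ x - r₁ x)| * (ε / (C + 1)) := by
        refine (Finset.abs_sum_le_sum_abs _ _).trans (Finset.sum_le_sum fun x _ => ?_)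
        rw [abs_mul, ← abs_mul (t - s), ← hinc]
        exact mul_le_mul_of_nonneg_left (hclose x) (abs_nonneg _)
    _ = |t - s| * C * (ε / (C + 1)) := by rw [← Finset.sum_mul, ← Finset.mul_sum]
    _ ≤ |t - s| * (C + 1) * (ε / (C + 1)) := by gcongr; linarith
    _ = ε * |t - s| := by field_simp

/-- a continuous implementable training rule admitting, for each group
and each profile of others' reports, a "connecting" reward model `r*` making the
outcome independent of the reported size, satisfies payment equivalence. -/
theorem continuous_connecting_rule_payment_equivalence
    [Fintype X] [Nonempty X] {n : ℕ} (wbar : ℕ) (hwbar : 1 ≤ wbar)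
    (Rdom : (X → ℝ) → Prop)
    (hdom : Rdom = (IsRewardSum (X := X)) ∨ Rdom = (IsRewardMax (X := X)))
    (ψ : (Fin n → X → ℝ) → (Fin n → ℕ) → (X → ℝ) → (X → ℝ))
    (hmodel : ∀ (r : Fin n → X → ℝ) (w : Fin n → ℕ) (π₀ : X → ℝ),
      (∀ j, Rdom (r j)) → IsModel π₀ → FullSupport π₀ → IsModel (ψ r w π₀))
    (himpl : ∃ p, DSICw Rdom wbar ψ p)
    (hcont : ContinuousRule ψ)
    (hstar : ∀ (i : Fin n) (r : Fin n → X → ℝ) (w : Fin n → ℕ) (π₀ : X → ℝ),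
      (∀ j, Rdom (r j)) → (∀ j, 1 ≤ w j ∧ w j ≤ wbar) →
      IsModel π₀ → FullSupport π₀ →
      ∃ rstar : X → ℝ, Rdom rstar ∧
        (Rdom = (IsRewardMax (X := X)) → rstar = fun _ => 1) ∧
        ∃ π : X → ℝ, ∀ wᵢ : ℕ, 1 ≤ wᵢ → wᵢ ≤ wbar →
          ψ (Function.update r i rstar) (Function.update w i wᵢ) π₀ = π)
    (p p' : (Fin n → X → ℝ) → (Fin n → ℕ) → (X → ℝ) → Fin n → ℝ)
    (hp : DSICw Rdom wbar ψ p) (hp' : DSICw Rdom wbar ψ p')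
    (i : Fin n) :
    ∃ g : (Fin n → X → ℝ) → (Fin n → ℕ) → (X → ℝ) → ℝ,
      (∀ (r : Fin n → X → ℝ) (w : Fin n → ℕ) (r₁ r₂ : X → ℝ) (w₁ w₂ : ℕ)
        (π₀ : X → ℝ),
        g (Function.update r i r₁) (Function.update w i w₁) π₀ =
          g (Function.update r i r₂) (Function.update w i w₂) π₀) ∧
      ∀ (r : Fin n → X → ℝ) (w : Fin n → ℕ) (π₀ : X → ℝ),
        (∀ j, Rdom (r j)) → (∀ j, 1 ≤ w j ∧ w j ≤ wbar) →
        IsModel π₀ → FullSupport π₀ →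
        p' r w π₀ i = p r w π₀ i + g r w π₀ := by
  have hconst (r : Fin n → X → ℝ) (w : Fin n → ℕ) (π₀ : X → ℝ) (hr : ∀ j, Rdom (r j))
      (hw : ∀ j, 1 ≤ w j ∧ w j ≤ wbar) (hπ : IsModel π₀) (hs : FullSupport π₀) :
      ∃ c : ℝ, ∀ (ρ : X → ℝ) (k : ℕ), Rdom ρ → 1 ≤ k ∧ k ≤ wbar →
        p' (Function.update r i ρ) (Function.update w i k) π₀ i -
          p (Function.update r i ρ) (Function.update w i k) π₀ i = c := by
    obtain ⟨rstar, hrs, hone, π, hπs⟩ := hstar i r w π₀ hr hw hπ hs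
    have hseg (ρ : X → ℝ) (hρ : Rdom ρ) (t : ℝ) (ht : t ∈ Set.Icc (0 : ℝ) 1) :
        Rdom fun x => ρ x + t * (rstar x - ρ x) := by
      rcases hdom with h | h
      · subst h
        exact hρ.segment hrs ht
      · rw [hone h]
        subst h
        exact hρ.segment_one ht
    refine ⟨_, fun ρ k hρ hk => (hcont.payment_sub_eq_of_segment hp hp' i hr hw hπ hs hk
      (hseg ρ hρ)).symm.trans (?_ : _ = p' (Function.update r i rstar) (Function.update w i 1) π₀ i
        - p (Function.update r i rstar) (Function.update w i 1) π₀ i)⟩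
    have h := hp.abs_payment_sub_le hp' i hr hw hπ hs hrs hrs ⟨le_rfl, hwbar⟩ hk
    rw [hπs k hk.1 hk.2, hπs 1 le_rfl hwbar] at h
    simpa [sub_eq_zero] using h
  by_cases hne : ∃ r₀, Rdom r₀
  · obtain ⟨r₀, hr₀⟩ := hne
    refine ⟨fun r w π₀ => p' (Function.update r i r₀) (Function.update w i 1) π₀ i -
      p (Function.update r i r₀) (Function.update w i 1) π₀ i, by simp, ?_⟩
    intro r w π₀ hr hw hπ hs
    obtain ⟨c, hc⟩ := hconst r w π₀ hr hw hπ hs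
    have h₁ := hc (r i) (w i) (hr i) (hw i)
    have h₂ := hc r₀ 1 hr₀ ⟨le_rfl, hwbar⟩
    simp only [Function.update_eq_self] at h₁
    simp only [h₂]
    linarith
  · exact ⟨fun _ _ _ => 0, by simp, fun r _ _ hr => (hne ⟨_, hr i⟩).elim⟩
end
end

section
/- Every continuous SW-Max training rule ψ satisfies payment equivalence: for any two payment rules p, p' implementing ψ in DSIC and each group i, there is a function g_i of (r⃗_{-i}, w⃗_{-i}, π₀) alone with p'_i(r⃗, w⃗, π₀) = p_i(r⃗, w⃗, π₀) + g_i(r⃗_{-i}, w⃗_{-i}, π₀) for all (r_i, w_i). -/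
open Finset

noncomputable section

variable {X : Type*}

/-- A function on `[0, 1]` whose increments are uniformly `o(|s - t|)` has equal endpoint values. -/
theorem eq_endpoints_of_uniform_small_increments (φ : ℝ → ℝ)
    (h : ∀ ε : ℝ, 0 < ε → ∃ δ : ℝ, 0 < δ ∧ ∀ s ∈ Set.Icc (0 : ℝ) 1, ∀ t ∈ Set.Icc (0 : ℝ) 1,
      |s - t| ≤ δ → |φ s - φ t| ≤ ε * |s - t|) :
    φ 0 = φ 1 := by
  have hderiv : ∀ t ∈ Set.Icc (0 : ℝ) 1, HasDerivWithinAt φ 0 (Set.Icc 0 1) t := by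
    intro t ht
    rw [hasDerivWithinAt_iff_isLittleO, Asymptotics.isLittleO_iff]
    intro ε hε
    obtain ⟨δ, hδ, H⟩ := h ε hε
    filter_upwards [self_mem_nhdsWithin,
      mem_nhdsWithin_of_mem_nhds (Metric.closedBall_mem_nhds t hδ)] with s hs hst
    rw [Metric.mem_closedBall, Real.dist_eq] at hst
    simpa [Real.norm_eq_abs] using H s hs t ht hst
  have := (convex_Icc (0 : ℝ) 1).norm_image_sub_le_of_norm_hasDerivWithin_le (C := 0) hderiv
    (by simp) (Set.left_mem_Icc.2 zero_le_one) (Set.right_mem_Icc.2 zero_le_one)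
  rw [zero_mul, norm_le_zero_iff, sub_eq_zero] at this
  exact this.symm

/-- Replacing the reward of group `i` changes the weighted aggregate only through group `i`. -/
theorem weighted_sum_update_sub {n : ℕ} (r : Fin n → X → ℝ) (w : Fin n → ℕ) (i : Fin n)
    (a b : X → ℝ) (x : X) :
    ∑ j, (w j : ℝ) * Function.update r i a j x - ∑ j, (w j : ℝ) * Function.update r i b j x =
      (w i : ℝ) * (a x - b x) := by
  rw [← Finset.sum_sub_distrib, Finset.sum_eq_single i]
  · simp [mul_sub]
  · intro j _ hj
    simp [Function.update_of_ne hj]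
  · simp

theorem valuation_const [Fintype X] {π : X → ℝ} (hπ : IsModel π) (c : ℝ) :
    valuation π (fun _ => c) = c := by
  rw [valuation, ← Finset.sum_mul, hπ.2, one_mul]

/-- Both normalizations admit a constant reward model with respect to which the domain is
star-shaped. -/
theorem exists_const_star_center [Fintype X] [Nonempty X] {Rdom : (X → ℝ) → Prop}
    (hdom : Rdom = (IsRewardSum (X := X)) ∨ Rdom = (IsRewardMax (X := X))) :
    ∃ c : ℝ, Rdom (fun _ => c) ∧
      ∀ r, Rdom r → ∀ t ∈ Set.Icc (0 : ℝ) 1, Rdom (fun x => (1 - t) * r x + t * c) := by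
  have hcard : (Fintype.card X : ℝ) ≠ 0 := Nat.cast_ne_zero.2 Fintype.card_ne_zero
  rcases hdom with rfl | rfl
  · refine ⟨(Fintype.card X : ℝ)⁻¹, ⟨fun _ => by positivity, by simp [hcard]⟩, ?_⟩
    rintro r ⟨h0, h1⟩ t ⟨ht0, ht1⟩
    refine ⟨fun x => ?_, ?_⟩
    · have := h0 x
      have : 0 ≤ 1 - t := by linarith
      positivity
    · rw [Finset.sum_add_distrib, ← Finset.mul_sum, h1]
      simp only [Finset.sum_const, Finset.card_univ, nsmul_eq_mul]
      field_simp
      ring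
  · refine ⟨1, ⟨fun _ => zero_le_one, fun _ => le_rfl, ⟨Classical.arbitrary X, rfl⟩⟩, ?_⟩
    rintro r ⟨h0, h1, x₀, hx₀⟩ t ⟨ht0, ht1⟩
    refine ⟨fun x => ?_, fun x => ?_, x₀, ?_⟩
    · have := h0 x
      have : 0 ≤ 1 - t := by linarith
      positivity
    · nlinarith [h1 x]
    · simp [hx₀]

section

variable [Fintype X] {n : ℕ} {wbar : ℕ} {Rdom : (X → ℝ) → Prop}
  {ψ : (Fin n → X → ℝ) → (Fin n → ℕ) → (X → ℝ) → (X → ℝ)}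
  {p p' : (Fin n → X → ℝ) → (Fin n → ℕ) → (X → ℝ) → Fin n → ℝ}

/-- The incentive constraint between two reports of group `i` with the same size. -/
theorem DSICw.payment_sub_le (hp : DSICw Rdom wbar ψ p) {r : Fin n → X → ℝ} {w : Fin n → ℕ}
    {π₀ : X → ℝ} (hr : ∀ j, Rdom (r j)) (hw : ∀ j, 1 ≤ w j ∧ w j ≤ wbar)
    (hπ₀ : IsModel π₀) (hfull : FullSupport π₀) (i : Fin n) {a b : X → ℝ}
    (ha : Rdom a) (hb : Rdom b) :
    p (Function.update r i a) w π₀ i - p (Function.update r i b) w π₀ i ≤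
      (w i : ℝ) * (valuation (ψ (Function.update r i a) w π₀) a -
        valuation (ψ (Function.update r i b) w π₀) a) := by
  have hra : ∀ j, Rdom (Function.update r i a j) := by
    intro j
    rcases eq_or_ne j i with rfl | hj
    · simpa using ha
    · simpa [Function.update_of_ne hj] using hr j
  have := hp (Function.update r i a) w i b (w i) π₀ hra hw hb (hw i).1 (hw i).2 hπ₀ hfull
  simp only [Function.update_self, Function.update_idem, Function.update_eq_self] at this
  linarith

/-- Two implementing payment rules have increments that differ by at most the pairing of the
change of the reward with the change of the model. -/
theorem abs_payment_gap_sub_le (hp : DSICw Rdom wbar ψ p) (hp' : DSICw Rdom wbar ψ p')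
    {r : Fin n → X → ℝ} {w : Fin n → ℕ} {π₀ : X → ℝ} (hr : ∀ j, Rdom (r j))
    (hw : ∀ j, 1 ≤ w j ∧ w j ≤ wbar) (hπ₀ : IsModel π₀) (hfull : FullSupport π₀) (i : Fin n)
    {a b : X → ℝ} (ha : Rdom a) (hb : Rdom b) :
    |(p' (Function.update r i a) w π₀ i - p (Function.update r i a) w π₀ i) -
        (p' (Function.update r i b) w π₀ i - p (Function.update r i b) w π₀ i)| ≤
      (w i : ℝ) * ∑ x, (ψ (Function.update r i a) w π₀ x -
        ψ (Function.update r i b) w π₀ x) * (a x - b x) := by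
  have h₁ := hp.payment_sub_le hr hw hπ₀ hfull i ha hb
  have h₂ := hp.payment_sub_le hr hw hπ₀ hfull i hb ha
  have h₃ := hp'.payment_sub_le hr hw hπ₀ hfull i ha hb
  have h₄ := hp'.payment_sub_le hr hw hπ₀ hfull i hb ha
  have hsum : ∀ π ρ : X → ℝ, ∑ x, (π x - ρ x) * (a x - b x) =
      (valuation π a - valuation ρ a) + (valuation ρ b - valuation π b) := by
    intro π ρ
    simp only [valuation, ← Finset.sum_sub_distrib, ← Finset.sum_add_distrib]
    exact Finset.sum_congr rfl fun x _ => by ring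
  rw [hsum, mul_add, abs_le]
  constructor <;> linarith

/-- Along a segment of admissible rewards the gap between two implementing payment rules is
constant. -/
theorem payment_gap_eq_of_segment (hcont : ContinuousRule ψ) (hp : DSICw Rdom wbar ψ p)
    (hp' : DSICw Rdom wbar ψ p') {r : Fin n → X → ℝ} {w : Fin n → ℕ} {π₀ : X → ℝ}
    (hr : ∀ j, Rdom (r j)) (hw : ∀ j, 1 ≤ w j ∧ w j ≤ wbar) (hπ₀ : IsModel π₀)
    (hfull : FullSupport π₀) (i : Fin n) (c : X → ℝ)
    (hseg : ∀ t ∈ Set.Icc (0 : ℝ) 1, Rdom (fun x => (1 - t) * r i x + t * c x)) :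
    p' r w π₀ i - p r w π₀ i =
      p' (Function.update r i c) w π₀ i - p (Function.update r i c) w π₀ i := by
  set ρ : ℝ → X → ℝ := fun t x => (1 - t) * r i x + t * c x with hρ
  set M : ℝ := (w i : ℝ) * ∑ x, |c x - r i x| + 1 with hM
  have hS : ∀ x, |c x - r i x| ≤ ∑ y, |c y - r i y| := fun x =>
    Finset.single_le_sum (f := fun y => |c y - r i y|) (fun y _ => abs_nonneg _)
      (Finset.mem_univ x)
  have hMpos : 0 < M := by positivity
  have hdiff : ∀ s t x, ρ s x - ρ t x = (s - t) * (c x - r i x) := by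
    intro s t x
    simp only [hρ]
    ring
  have key := eq_endpoints_of_uniform_small_increments
    (fun t => p' (Function.update r i (ρ t)) w π₀ i - p (Function.update r i (ρ t)) w π₀ i) ?_
  · have h0 : ρ 0 = r i := by funext x; simp [hρ]
    have h1 : ρ 1 = c := by funext x; simp [hρ]
    simpa [h0, h1] using key
  intro ε hε
  obtain ⟨δ, hδ, H⟩ := hcont (ε / M) (by positivity)
  refine ⟨δ / M, by positivity, fun s hs t ht hst => ?_⟩
  have hclose := H (Function.update r i (ρ s)) (Function.update r i (ρ t)) w w π₀ hπ₀ hfull (by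
    intro x
    rw [weighted_sum_update_sub, hdiff, abs_mul, abs_mul, Nat.abs_cast]
    calc (w i : ℝ) * (|s - t| * |c x - r i x|)
        = |s - t| * ((w i : ℝ) * |c x - r i x|) := by ring
      _ ≤ δ / M * M := by
        have := mul_le_mul_of_nonneg_left (hS x) (Nat.cast_nonneg (α := ℝ) (w i))
        gcongr
        linarith
      _ = δ := div_mul_cancel₀ _ hMpos.ne')
  refine (abs_payment_gap_sub_le hp hp' hr hw hπ₀ hfull i (hseg s hs) (hseg t ht)).trans ?_
  calc (w i : ℝ) * ∑ x, (ψ (Function.update r i (ρ s)) w π₀ x -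
          ψ (Function.update r i (ρ t)) w π₀ x) * (ρ s x - ρ t x)
      ≤ (w i : ℝ) * ∑ x, ε / M * (|s - t| * |c x - r i x|) := by
        refine mul_le_mul_of_nonneg_left (Finset.sum_le_sum fun x _ => ?_) (Nat.cast_nonneg _)
        refine (le_abs_self _).trans ?_
        rw [hdiff, abs_mul, abs_mul]
        gcongr
        exact hclose x
    _ = ε / M * |s - t| * ((w i : ℝ) * ∑ x, |c x - r i x|) := by
        simp only [← Finset.mul_sum]
        ring
    _ ≤ ε / M * |s - t| * M := by
        gcongr
        linarith
    _ = ε * |s - t| := by field_simp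

/-- A group reporting a constant reward is charged at least as much under any other size. -/
theorem DSICw.payment_const_le {f : ℝ → ℝ} (hψ : SWMaxRule f Rdom ψ) (hp : DSICw Rdom wbar ψ p)
    {r : Fin n → X → ℝ} {w : Fin n → ℕ} {π₀ : X → ℝ} (hr : ∀ j, Rdom (r j))
    (hw : ∀ j, 1 ≤ w j ∧ w j ≤ wbar) (hπ₀ : IsModel π₀) (hfull : FullSupport π₀) (i : Fin n)
    {c : ℝ} (hc : r i = fun _ => c) {k : ℕ} (hk : 1 ≤ k) (hk' : k ≤ wbar) :
    p r w π₀ i ≤ p r (Function.update w i k) π₀ i := by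
  have h := hp r w i (r i) k π₀ hr hw (hr i) hk hk' hπ₀ hfull
  rw [Function.update_eq_self, hc, valuation_const (hψ r w π₀ hr hπ₀ hfull).1,
    valuation_const (hψ r _ π₀ hr hπ₀ hfull).1] at h
  linarith

/-- A group reporting a constant reward pays the same amount for every size. -/
theorem DSICw.payment_const_eq {f : ℝ → ℝ} (hψ : SWMaxRule f Rdom ψ) (hp : DSICw Rdom wbar ψ p)
    {r : Fin n → X → ℝ} {w : Fin n → ℕ} {π₀ : X → ℝ} (hr : ∀ j, Rdom (r j))
    (hw : ∀ j, 1 ≤ w j ∧ w j ≤ wbar) (hπ₀ : IsModel π₀) (hfull : FullSupport π₀) (i : Fin n)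
    {c : ℝ} (hc : r i = fun _ => c) {k : ℕ} (hk : 1 ≤ k) (hk' : k ≤ wbar) :
    p r w π₀ i = p r (Function.update w i k) π₀ i := by
  refine le_antisymm (hp.payment_const_le hψ hr hw hπ₀ hfull i hc hk hk') ?_
  have hw' : ∀ j, 1 ≤ Function.update w i k j ∧ Function.update w i k j ≤ wbar := by
    intro j
    rcases eq_or_ne j i with rfl | hj
    · simpa using ⟨hk, hk'⟩
    · simpa [Function.update_of_ne hj] using hw j
  simpa using hp.payment_const_le hψ hr hw' hπ₀ hfull i hc (hw i).1 (hw i).2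

end

/-- every continuous SW-Max training rule satisfies payment
equivalence. -/
theorem continuous_swmax_payment_equivalence
    [Fintype X] [Nonempty X] {n : ℕ} (wbar : ℕ) (hwbar : 1 ≤ wbar)
    (f : ℝ → ℝ) (hconv : ConvexOn ℝ (Set.Ioi 0) f) (hf1 : f 1 = 0)
    (Rdom : (X → ℝ) → Prop)
    (hdom : Rdom = (IsRewardSum (X := X)) ∨ Rdom = (IsRewardMax (X := X)))
    (ψ : (Fin n → X → ℝ) → (Fin n → ℕ) → (X → ℝ) → (X → ℝ))
    (hψ : SWMaxRule f Rdom ψ)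
    (hcont : ContinuousRule ψ)
    (p p' : (Fin n → X → ℝ) → (Fin n → ℕ) → (X → ℝ) → Fin n → ℝ)
    (hp : DSICw Rdom wbar ψ p) (hp' : DSICw Rdom wbar ψ p')
    (i : Fin n) :
    ∃ g : (Fin n → X → ℝ) → (Fin n → ℕ) → (X → ℝ) → ℝ,
      (∀ (r : Fin n → X → ℝ) (w : Fin n → ℕ) (r₁ r₂ : X → ℝ) (w₁ w₂ : ℕ)
        (π₀ : X → ℝ),
        g (Function.update r i r₁) (Function.update w i w₁) π₀ =
          g (Function.update r i r₂) (Function.update w i w₂) π₀) ∧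
      ∀ (r : Fin n → X → ℝ) (w : Fin n → ℕ) (π₀ : X → ℝ),
        (∀ j, Rdom (r j)) → (∀ j, 1 ≤ w j ∧ w j ≤ wbar) →
        IsModel π₀ → FullSupport π₀ →
        p' r w π₀ i = p r w π₀ i + g r w π₀ := by
  obtain ⟨c, hc, hstar⟩ := exists_const_star_center hdom
  refine ⟨fun r w π₀ =>
    p' (Function.update r i fun _ => c) (Function.update w i 1) π₀ i -
      p (Function.update r i fun _ => c) (Function.update w i 1) π₀ i, ?_, ?_⟩
  · intro r w r₁ r₂ w₁ w₂ π₀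
    simp only [Function.update_idem]
  · intro r w π₀ hr hw hπ₀ hfull
    have hrc : ∀ j, Rdom (Function.update r i (fun _ => c) j) := by
      intro j
      rcases eq_or_ne j i with rfl | hj
      · simpa using hc
      · simpa [Function.update_of_ne hj] using hr j
    have hgap := payment_gap_eq_of_segment hcont hp hp' hr hw hπ₀ hfull i (fun _ => c)
      (hstar (r i) (hr i))
    have hci : Function.update r i (fun _ => c) i = fun _ => c := Function.update_self ..
    have h₁ := hp.payment_const_eq hψ hrc hw hπ₀ hfull i hci le_rfl hwbar
    have h₂ := hp'.payment_const_eq hψ hrc hw hπ₀ hfull i hci le_rfl hwbar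
    linarith
end
end

section
/- Let ψ be a SW-Max training rule. If profiles of reward models r⃗ and r̂⃗ satisfy max_{x∈X} |r̂_i(x) − r_i(x)| ≤ ε for every group i, then the affine social welfare of the outcome trained on the noisy input, evaluated at the true profile, is nearly optimal: ASW(ψ(r̂⃗, w⃗, π₀); r⃗, w⃗, π₀) ≥ ASW(ψ(r⃗, w⃗, π₀); r⃗, w⃗, π₀) − 2ε·Σ_{i=1}^n w_i, for every size vector w⃗ and every full-support initial model π₀. -/
open Finset

noncomputable section

variable {X : Type*}

/-- Valuations under a model are 1-Lipschitz in the reward for the sup distance. -/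
lemma IsModel.abs_valuation_sub_le [Fintype X] {π r s : X → ℝ} {ε : ℝ}
    (hπ : IsModel π) (h : ∀ x, |s x - r x| ≤ ε) :
    |valuation π s - valuation π r| ≤ ε := by
  unfold valuation
  rw [← Finset.sum_sub_distrib]
  calc |∑ x, (π x * s x - π x * r x)|
      ≤ ∑ x, |π x * s x - π x * r x| := Finset.abs_sum_le_sum_abs _ _
    _ ≤ ∑ x, π x * ε := by
        refine Finset.sum_le_sum fun x _ => ?_
        rw [← mul_sub, abs_mul, abs_of_nonneg (hπ.1 x)]
        exact mul_le_mul_of_nonneg_left (h x) (hπ.1 x)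
    _ = ε := by rw [← Finset.sum_mul, hπ.2, one_mul]

/-- Perturbing each reward by at most `ε` moves the affine social welfare of a model by at most
`ε` times the total weight. -/
lemma IsModel.abs_ASW_sub_le [Fintype X] {n : ℕ} {f : ℝ → ℝ} {r s : Fin n → X → ℝ}
    {w : Fin n → ℕ} {π π₀ : X → ℝ} {ε : ℝ}
    (hπ : IsModel π) (h : ∀ j x, |s j x - r j x| ≤ ε) :
    |ASW f s w π π₀ - ASW f r w π π₀| ≤ ε * ∑ j, (w j : ℝ) := by
  unfold ASW
  rw [sub_sub_sub_cancel_right, ← Finset.sum_sub_distrib, Finset.mul_sum]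
  refine (Finset.abs_sum_le_sum_abs _ _).trans (Finset.sum_le_sum fun j _ => ?_)
  rw [← mul_sub, abs_mul, Nat.abs_cast, mul_comm ε]
  exact mul_le_mul_of_nonneg_left (hπ.abs_valuation_sub_le (h j)) (Nat.cast_nonneg _)

/-- training on an ε-perturbed reward profile loses at most
`2·ε·Σᵢ wᵢ` of affine social welfare evaluated at the true profile. -/
theorem swmax_noisy_input_asw_bound
    [Fintype X] [Nonempty X] {n : ℕ} (f : ℝ → ℝ)
    (hconv : ConvexOn ℝ (Set.Ioi 0) f) (hf1 : f 1 = 0)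
    (Rdom : (X → ℝ) → Prop)
    (hdom : Rdom = (IsRewardSum (X := X)) ∨ Rdom = (IsRewardMax (X := X)))
    (ψ : (Fin n → X → ℝ) → (Fin n → ℕ) → (X → ℝ) → (X → ℝ))
    (hψ : SWMaxRule f Rdom ψ)
    (ε : ℝ) (hε : 0 ≤ ε)
    (r rhat : Fin n → X → ℝ)
    (hr : ∀ j, Rdom (r j)) (hrhat : ∀ j, Rdom (rhat j))
    (hclose : ∀ j x, |rhat j x - r j x| ≤ ε)
    (w : Fin n → ℕ) (hw : ∀ j, 1 ≤ w j)
    (π₀ : X → ℝ) (hπ₀ : IsModel π₀) (hfs : FullSupport π₀) :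
    ASW f r w (ψ rhat w π₀) π₀ ≥
      ASW f r w (ψ r w π₀) π₀ - 2 * ε * ∑ j, (w j : ℝ) := by
  obtain ⟨hmodel, -⟩ := hψ r w π₀ hr hπ₀ hfs
  obtain ⟨hmodel_hat, hmax_hat⟩ := hψ rhat w π₀ hrhat hπ₀ hfs
  have hopt := hmax_hat _ hmodel
  have htrue := abs_le.mp (hmodel.abs_ASW_sub_le (f := f) (w := w) (π₀ := π₀) hclose)
  have hnoisy := abs_le.mp (hmodel_hat.abs_ASW_sub_le (f := f) (w := w) (π₀ := π₀) hclose)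
  linarith [htrue.1, hnoisy.2]
end
end
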